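/- arXiv:2201.11004 — 6 statements merged into one kernel-verified Lean document; each statement's English description precedes it below -/
import Mathlib

section
/- Let d be a natural number and p a prime. If G is a finite p-subgroup of GL_d(ℚ) (i.e., a finite subgroup all of whose elements have p-power order, equivalently whose cardinality is a power of p), then v_p(|G|) ≤ M_ℚ(d,p), where M_ℚ(d,p) = ⌊d/(p-1)⌋ + ⌊d/(p(p-1))⌋ + ⌊d/(p²(p-1))⌋ + ⋯ (the terms vanish for large k, so the sum may be taken over 0 ≤ k ≤ d). -/
open Polynomial in
/-- An irreducible factor of the characteristic polynomial of a matrix `A` with `A ^ n = 1`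
divides `X ^ n - 1`. -/
theorem Matrix.irreducible_dvd_X_pow_sub_one {K ι : Type*} [Field K] [Fintype ι] [DecidableEq ι]
    {A : Matrix ι ι K} {n : ℕ} (hA : A ^ n = 1) {q : K[X]} (hq : Irreducible q)
    (hdvd : q ∣ A.charpoly) : q ∣ X ^ n - 1 := by
  obtain ⟨μ, hμ⟩ := IsAlgClosed.exists_aeval_eq_zero (AlgebraicClosure K) q
    (Polynomial.degree_pos_of_irreducible hq).ne'
  set φ := algebraMap K (AlgebraicClosure K)
  have hroot : (φ.mapMatrix A).charpoly.IsRoot μ := by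
    rw [RingHom.mapMatrix_apply, Matrix.charpoly_map, IsRoot.def, eval_map_algebraMap]
    exact aeval_eq_zero_of_dvd_aeval_eq_zero hdvd hμ
  rw [← Matrix.mem_spectrum_iff_isRoot_charpoly] at hroot
  have hpow := spectrum.pow_mem_pow _ n hroot
  rw [← map_pow, hA, map_one] at hpow
  have hμn : μ ^ n = 1 := by
    rcases subsingleton_or_nontrivial (Matrix ι ι (AlgebraicClosure K)) with h | h
    · simp [spectrum.of_subsingleton] at hpow
    · simpa [spectrum.one_eq] using hpow
  have hmin := minpoly.dvd K μ (p := X ^ n - 1) (by simp [hμn])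
  exact ((minpoly.eq_of_irreducible hq hμ) ▸ Dvd.intro _ rfl : q ∣ minpoly K μ).trans hmin

open Polynomial in
theorem Polynomial.eq_cyclotomic_prime_pow_of_dvd {p k : ℕ} (hp : p.Prime) {q : ℚ[X]}
    (hq : Irreducible q) (hmonic : q.Monic) (hdvd : q ∣ X ^ p ^ k - 1) :
    ∃ j, q = cyclotomic (p ^ j) ℚ := by
  have hpos : 0 < p ^ k := pow_pos hp.pos k
  rw [← prod_cyclotomic_eq_X_pow_sub_one hpos, hq.prime.dvd_finsetProd_iff] at hdvd
  obtain ⟨m, hm, hqm⟩ := hdvd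
  obtain ⟨j, -, rfl⟩ := (Nat.dvd_prime_pow hp).1 (Nat.dvd_of_mem_divisors hm)
  exact ⟨j, eq_of_monic_of_associated hmonic (cyclotomic.monic _ ℚ)
    (hq.associated_of_dvd (cyclotomic.irreducible_rat (pow_pos hp.pos j)) hqm)⟩

open Polynomial in
theorem Polynomial.exists_nextCoeff_cyclotomic_prime_pow {p : ℕ} (hp : p.Prime) (j : ℕ) :
    ∃ i : ℕ, (cyclotomic (p ^ j) ℚ).nextCoeff = p * i - (cyclotomic (p ^ j) ℚ).natDegree ∧
      i * (p - 1) ≤ (cyclotomic (p ^ j) ℚ).natDegree ∧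
      (i = 0 → cyclotomic (p ^ j) ℚ = X - 1) := by
  have : Fact p.Prime := ⟨hp⟩
  have hp2 := hp.two_le
  obtain _ | _ | j := j
  · refine ⟨0, ?_, by simp, by simp⟩
    rw [pow_zero, cyclotomic_one, ← C_1, nextCoeff_X_sub_C, natDegree_X_sub_C]
    simp
  · have hdeg : (cyclotomic p ℚ).natDegree = p - 1 := by
      rw [natDegree_cyclotomic, Nat.totient_prime hp]
    refine ⟨1, ?_, by simp [hdeg], by simp⟩
    rw [zero_add, pow_one, nextCoeff_of_natDegree_pos (by omega), hdeg, cyclotomic_prime,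
      finsetSum_coeff]
    simp only [coeff_X_pow]
    rw [Finset.sum_ite_eq, if_pos (Finset.mem_range.2 (by omega)), Nat.cast_sub (by omega)]
    simp
  · have hdeg : (cyclotomic (p ^ (j + 2)) ℚ).natDegree = p ^ j * (p - 1) * p := by
      rw [natDegree_cyclotomic, Nat.totient_prime_pow_succ hp]; ring
    have hpos : 0 < p ^ j * (p - 1) := Nat.mul_pos (pow_pos hp.pos j) (by omega)
    refine ⟨p ^ j * (p - 1), ?_, ?_, fun h => absurd h hpos.ne'⟩
    · have hdeg' : 0 < p ^ j * (p - 1) * p := Nat.mul_pos hpos hp.pos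
      rw [nextCoeff_of_natDegree_pos (hdeg ▸ hdeg'), hdeg, show p ^ (j + 2) = p ^ (j + 1) * p by ring,
        ← cyclotomic_expand_eq_cyclotomic hp (dvd_pow_self p j.succ_ne_zero) ℚ,
        coeff_expand hp.pos, if_neg]
      · push_cast
        ring
      · intro h
        have := (Nat.dvd_sub_iff_right hdeg' (Dvd.intro_left _ rfl)).1 h
        exact hp.one_lt.ne' (Nat.dvd_one.1 this)
    · rw [hdeg]
      gcongr
      omega

open Polynomial in
theorem Polynomial.exists_nextCoeff_prod_cyclotomic_prime_pow {p : ℕ} (hp : p.Prime)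
    (s : Multiset ℚ[X]) (hs : ∀ q ∈ s, ∃ j, q = cyclotomic (p ^ j) ℚ) :
    ∃ i : ℕ, s.prod.nextCoeff = p * i - s.prod.natDegree ∧
      i * (p - 1) ≤ s.prod.natDegree ∧ (i = 0 → s.prod = (X - 1) ^ s.card) := by
  induction s using Multiset.induction_on with
  | empty => exact ⟨0, by simp [nextCoeff]⟩
  | cons q s ih =>
    obtain ⟨i, hi, hile, hi0⟩ := ih fun q hq => hs q (Multiset.mem_cons_of_mem hq)
    obtain ⟨j, rfl⟩ := hs q (Multiset.mem_cons_self q s)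
    obtain ⟨i', hi', hile', hi0'⟩ := exists_nextCoeff_cyclotomic_prime_pow hp j
    have hq : (cyclotomic (p ^ j) ℚ).Monic := cyclotomic.monic _ ℚ
    have hmonic : s.prod.Monic := by
      simpa using monic_multiset_prod_of_monic s id fun q hq => by
        obtain ⟨j, rfl⟩ := hs q (Multiset.mem_cons_of_mem hq)
        exact cyclotomic.monic _ ℚ
    refine ⟨i' + i, ?_, ?_, fun h => ?_⟩
    · rw [Multiset.prod_cons, hq.nextCoeff_mul hmonic, hq.natDegree_mul hmonic, hi, hi']
      push_cast
      ring
    · rw [Multiset.prod_cons, hq.natDegree_mul hmonic, add_mul]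
      omega
    · rw [Multiset.prod_cons, Multiset.card_cons, hi0 (by omega), hi0' (by omega)]
      ring

open Polynomial UniqueFactorizationMonoid in
/-- The trace of a rational `d × d` matrix of `p`-power order is `d - p * i` with
`0 ≤ i ≤ d / (p - 1)`, and `i = 0` only for the identity matrix. -/
theorem Matrix.exists_trace_eq_of_pow_prime_pow_eq_one {ι : Type*} [Fintype ι] [DecidableEq ι]
    {p k : ℕ} (hp : p.Prime) {A : Matrix ι ι ℚ} (hA : A ^ p ^ k = 1) :
    ∃ i : ℕ, A.trace = Fintype.card ι - p * i ∧ i ≤ Fintype.card ι / (p - 1) ∧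
      (i = 0 → A = 1) := by
  have hmonic := A.charpoly_monic
  obtain ⟨i, hi, hile, hi0⟩ := exists_nextCoeff_prod_cyclotomic_prime_pow hp
    (normalizedFactors A.charpoly) fun q hq =>
      have hirr := irreducible_of_normalized_factor q hq
      eq_cyclotomic_prime_pow_of_dvd hp hirr
        ((normalize_normalized_factor q hq) ▸ monic_normalize hirr.ne_zero)
        (irreducible_dvd_X_pow_sub_one hA hirr (dvd_of_mem_normalizedFactors hq))
  rw [prod_normalizedFactors_eq hmonic.ne_zero, hmonic.normalize_eq_self] at hi hile hi0
  rw [A.charpoly_natDegree_eq_dim] at hi hile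
  refine ⟨i, by rw [A.trace_eq_neg_charpoly_nextCoeff, hi]; ring,
    (Nat.le_div_iff_mul_le (Nat.sub_pos_of_lt hp.one_lt)).2 hile, fun h => ?_⟩
  have hsq : Squarefree (minpoly ℚ A) :=
    (X_pow_sub_one_separable_iff.2 (by simp [hp.ne_zero])).squarefree.squarefree_of_dvd
      (minpoly.dvd ℚ A (p := X ^ p ^ k - 1) (by simp [hA]))
  have hdvd : minpoly ℚ A ∣ X - 1 :=
    hsq.isRadical _ _ (hi0 h ▸ A.minpoly_dvd_charpoly)
  simpa [sub_eq_zero] using aeval_eq_zero_of_dvd_aeval_eq_zero hdvd (minpoly.aeval ℚ A)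

open CategoryTheory MonoidalCategory in
theorem FDRep.exists_character_eq_pow {k G : Type} [Field k] [Group G] (V : FDRep k G) (n : ℕ) :
    ∃ W : FDRep k G, W.character = V.character ^ n := by
  induction n with
  | zero =>
    refine ⟨FDRep.of (Representation.trivial k G k), ?_⟩
    ext g
    have : (FDRep.of (Representation.trivial k G k)).ρ g = LinearMap.id := rfl
    rw [FDRep.character, this]
    exact (LinearMap.trace_id k k).trans (by simp)
  | succ n ih =>
    obtain ⟨W, hW⟩ := ih
    exact ⟨W ⊗ V, by rw [FDRep.char_tensor, hW, pow_succ]⟩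

open Polynomial in
/-- Integer polynomials in a rational character have integral average. -/
theorem FDRep.exists_sum_aeval_character_eq_card_mul {G : Type} [Group G] [Fintype G] (V : FDRep ℚ G)
    (P : ℤ[X]) : ∃ z : ℤ, ∑ g : G, aeval (V.character g) P = Nat.card G * z := by
  induction P using Polynomial.induction_on' with
  | add P Q hP hQ =>
    obtain ⟨y, hy⟩ := hP
    obtain ⟨z, hz⟩ := hQ
    exact ⟨y + z, by simp [Finset.sum_add_distrib, hy, hz, mul_add]⟩
  | monomial n a =>
    have hcard : (Nat.card G : ℚ) ≠ 0 := Nat.cast_ne_zero.2 Nat.card_pos.ne'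
    let _ : Invertible (Nat.card G : ℚ) := invertibleOfNonzero hcard
    obtain ⟨W, hW⟩ := V.exists_character_eq_pow n
    have h := W.average_char_eq_finrank_invariants
    rw [inv_mul_eq_iff_eq_mul₀ hcard, hW] at h
    refine ⟨a * Module.finrank ℚ (Representation.invariants W.ρ), ?_⟩
    simp only [Pi.pow_apply] at h
    simp only [aeval_monomial, ← Finset.mul_sum, h, algebraMap_int_eq, eq_intCast]
    push_cast
    ring

open Polynomial in
/-- Schur's divisibility: if a rational character `χ` takes on nontrivial elements only values
`χ 1 - p * i` with `1 ≤ i ≤ m`, then the group order divides `p ^ m * m!`. -/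
theorem FDRep.card_dvd_pow_mul_factorial {G : Type} [Group G] [Fintype G] (V : FDRep ℚ G)
    {d p m : ℕ} (h1 : V.character 1 = d)
    (h : ∀ g ≠ 1, ∃ i ∈ Finset.Icc 1 m, V.character g = d - p * i) :
    Nat.card G ∣ p ^ m * m.factorial := by
  classical
  obtain ⟨z, hz⟩ := V.exists_sum_aeval_character_eq_card_mul
    (∏ i ∈ Finset.Icc 1 m, (X - C ((d : ℤ) - p * i)))
  have heval (g : G) : aeval (V.character g) (∏ i ∈ Finset.Icc 1 m, (X - C ((d : ℤ) - p * i))) =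
      ∏ i ∈ Finset.Icc 1 m, (V.character g - (d - p * i)) := by
    simp [map_prod]
  simp only [heval] at hz
  rw [Finset.sum_eq_single 1] at hz
  · have hprod : ∏ i ∈ Finset.Icc 1 m, (V.character 1 - (d - p * i)) =
        ((p ^ m * m.factorial : ℕ) : ℚ) := by
      simp only [h1, sub_sub_cancel]
      rw [Finset.prod_mul_distrib, Finset.prod_const, Nat.card_Icc, ← Nat.cast_prod,
        ← Finset.Ico_add_one_right_eq_Icc, Finset.prod_Ico_id_eq_factorial]
      simp
    rw [hprod] at hz
    exact Int.natCast_dvd_natCast.1 ⟨z, by exact_mod_cast hz⟩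
  · intro g _ hg
    obtain ⟨i, hi, hgi⟩ := h g hg
    exact Finset.prod_eq_zero hi (by rw [hgi, sub_self])
  · simp

theorem padicValNat_pow_mul_factorial_div (d : ℕ) {p : ℕ} (hp : p.Prime) :
    padicValNat p (p ^ (d / (p - 1)) * (d / (p - 1)).factorial) =
      ∑ k ∈ Finset.range (d + 1), d / (p ^ k * (p - 1)) := by
  have : Fact p.Prime := ⟨hp⟩
  have hlog : Nat.log p (d / (p - 1)) < d + 1 :=
    Nat.lt_succ_of_le ((Nat.log_le_self _ _).trans (Nat.div_le_self _ _))
  rw [padicValNat.mul (pow_ne_zero _ hp.ne_zero) (Nat.factorial_ne_zero _),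
    padicValNat.prime_pow, padicValNat_factorial hlog, Finset.range_eq_Ico,
    Finset.sum_eq_sum_Ico_succ_bot d.succ_pos]
  simp only [pow_zero, one_mul, Nat.div_div_eq_div_mul, mul_comm (p - 1)]

/-- **Minkowski's bound.** If `G` is a finite `p`-subgroup of `GL_d(ℚ)`, then
`v_p(|G|) ≤ M_ℚ(d,p) = ∑_{k≥0} ⌊d/(p^k(p-1))⌋`. -/
theorem minkowski_bound_linear (d p : ℕ) (hp : p.Prime)
    (G : Subgroup (GL (Fin d) ℚ)) (hG : Finite G)
    (hcard : ∃ α : ℕ, Nat.card G = p ^ α) :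
    padicValNat p (Nat.card G) ≤ ∑ k ∈ Finset.range (d + 1), d / (p ^ k * (p - 1)) := by
  have : Fact p.Prime := ⟨hp⟩
  have : Fintype G := Fintype.ofFinite G
  obtain ⟨α, hα⟩ := hcard
  let ρ : Representation ℚ G (Fin d → ℚ) :=
    (Matrix.toLinAlgEquiv' : Matrix (Fin d) (Fin d) ℚ ≃ₐ[ℚ] _).toMonoidHom.comp
      ((Units.coeHom _).comp G.subtype)
  have hchar (g : G) : (FDRep.of ρ).character g = (g : GL (Fin d) ℚ).val.trace :=
    Matrix.trace_toLin'_eq _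
  rw [← padicValNat_pow_mul_factorial_div d hp]
  refine padicValNat_dvd_iff_le (mul_ne_zero (pow_ne_zero _ hp.ne_zero)
    (Nat.factorial_ne_zero _)) |>.1 (pow_padicValNat_dvd.trans ?_)
  refine (FDRep.of ρ).card_dvd_pow_mul_factorial (d := d) (by simp [hchar]) fun g hg => ?_
  have hpow : (g : GL (Fin d) ℚ).val ^ p ^ α = 1 := by
    rw [← hα, ← Units.val_pow_eq_pow_val, ← Subgroup.coe_pow, pow_card_eq_one']
    simp
  obtain ⟨i, hi, hile, hi0⟩ := Matrix.exists_trace_eq_of_pow_prime_pow_eq_one hp hpow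
  rw [Fintype.card_fin] at hi hile
  refine ⟨i, Finset.mem_Icc.2 ⟨Nat.one_le_iff_ne_zero.2 fun h => hg ?_, hile⟩, by rw [hchar, hi]⟩
  exact Subtype.ext (Units.ext (hi0 h))
end

section
/- Let k be a number field, d a natural number, and p ≥ 3 a prime. If G is a finite p-subgroup of Aut(A^d_k), then there exists an injective group homomorphism G → GL_d(k). -/
section

open Filter Topology

theorem Real.abs_log_one_add_add_sub_le {x y : ℝ} (hx : 0 ≤ x) (hy : 0 ≤ y) :
    |Real.log (1 + x + y) - x| ≤ x ^ 2 + y := by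
  have h1 : Real.log (1 + x + y) ≤ x + y := by
    have := Real.log_le_sub_one_of_pos (show 0 < 1 + x + y by positivity)
    linarith
  have h2 : 2 * x / (x + 2) ≤ Real.log (1 + x) := Real.le_log_one_add_of_nonneg hx
  have h3 : Real.log (1 + x) ≤ Real.log (1 + x + y) :=
    Real.log_le_log (by positivity) (by linarith)
  have h4 : x - x ^ 2 ≤ 2 * x / (x + 2) := by
    rw [le_div_iff₀ (by positivity)]
    nlinarith [pow_nonneg hx 3, pow_nonneg hx 2]
  rw [abs_le]
  constructor <;> nlinarith [pow_nonneg hx 2]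

theorem hasSum_log_of_hasProd {ι : Type*} {f : ι → ℝ} {a : ℝ} (hf : ∀ i, f i ≠ 0) (ha : a ≠ 0)
    (h : HasProd f a) : HasSum (fun i ↦ Real.log (f i)) (Real.log a) := by
  have := (Real.continuousAt_log ha).tendsto.comp h
  refine this.congr fun s ↦ ?_
  simp only [Function.comp_apply]
  rw [Real.log_prod (fun i _ ↦ hf i)]

theorem summable_primes_sq_inv : Summable fun ℓ : Nat.Primes ↦ (((ℓ : ℕ) : ℝ) ^ 2)⁻¹ :=
  (Real.summable_nat_pow_inv.mpr one_lt_two).comp_injective Subtype.val_injective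

theorem summable_add_three_pow_div (D : ℕ) :
    Summable fun e : ℕ ↦ ((e : ℝ) + 3) ^ D * ((2 : ℝ) ^ e)⁻¹ := by
  have h := summable_pow_mul_geometric_of_norm_lt_one (R := ℝ) D (r := 1 / 2) (by norm_num)
  have h3 := (summable_nat_add_iff 3).mpr h
  refine (h3.mul_left 8).congr fun e ↦ ?_
  push_cast
  rw [pow_add, one_div, inv_pow]
  ring

theorem tendsto_neg_log_sub_one_atTop :
    Tendsto (fun s : ℝ ↦ -Real.log (s - 1)) (𝓝[>] 1) atTop := by
  refine tendsto_neg_atBot_atTop.comp (Real.tendsto_log_nhdsGT_zero.comp ?_)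
  refine tendsto_nhdsWithin_iff.mpr ⟨?_, ?_⟩
  · have : Tendsto (fun s : ℝ ↦ s - 1) (𝓝 1) (𝓝 (1 - 1)) :=
      (continuous_id.sub continuous_const).tendsto 1
    rw [sub_self] at this
    exact this.mono_left nhdsWithin_le_nhds
  · filter_upwards [self_mem_nhdsWithin] with s hs
    exact sub_pos.mpr (Set.mem_Ioi.mp hs)

section

variable {f : ℕ → ℝ} {D : ℕ}

/-- The bound for the difference between an Euler factor's logarithm and its linear term. -/
noncomputable def eulerBound (D : ℕ) : ℝ :=
  (2 ^ D) ^ 2 + ∑' e : ℕ, ((e : ℝ) + 3) ^ D * ((2 : ℝ) ^ e)⁻¹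

theorem abs_log_eulerFactor_sub_le (hf1 : f 1 = 1) (hnn : ∀ n, 0 ≤ f n)
    (hbd : ∀ ℓ e : ℕ, ℓ.Prime → f (ℓ ^ e) ≤ (e + 1) ^ D) {s : ℝ} (hs : 1 < s)
    {ℓ : ℕ} (hℓ : ℓ.Prime) (hsum : Summable fun e : ℕ ↦ f (ℓ ^ e) * ((ℓ ^ e : ℕ) : ℝ) ^ (-s)) :
    1 ≤ ∑' e : ℕ, f (ℓ ^ e) * ((ℓ ^ e : ℕ) : ℝ) ^ (-s) ∧
    |Real.log (∑' e : ℕ, f (ℓ ^ e) * ((ℓ ^ e : ℕ) : ℝ) ^ (-s)) - f ℓ * (ℓ : ℝ) ^ (-s)| ≤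
      eulerBound D * ((ℓ : ℝ) ^ 2)⁻¹ := by
  have hℓ0 : (0 : ℝ) < ℓ := by exact_mod_cast hℓ.pos
  have hℓ2 : (2 : ℝ) ≤ ℓ := by exact_mod_cast hℓ.two_le
  have hpow : ∀ n : ℕ, 1 ≤ n → (n : ℝ) ^ (-s) ≤ (n : ℝ)⁻¹ := fun n hn ↦ by
    rw [← Real.rpow_neg_one]
    exact Real.rpow_le_rpow_of_exponent_le (by exact_mod_cast hn) (by linarith)
  have hsplit := hsum.sum_add_tsum_nat_add 2
  rw [Finset.sum_range_succ, Finset.sum_range_one] at hsplit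
  simp only [pow_zero, Nat.cast_one, Real.one_rpow, mul_one, hf1, pow_one] at hsplit
  have hsum2 := (summable_nat_add_iff 2).mpr hsum
  set y := ∑' e : ℕ, f (ℓ ^ (e + 2)) * ((ℓ ^ (e + 2) : ℕ) : ℝ) ^ (-s) with hy_def
  have hx : 0 ≤ f ℓ * (ℓ : ℝ) ^ (-s) := mul_nonneg (hnn _) (by positivity)
  have hy : 0 ≤ y := tsum_nonneg fun e ↦ mul_nonneg (hnn _) (by positivity)
  have hyle : y ≤ (∑' e : ℕ, ((e : ℝ) + 3) ^ D * ((2 : ℝ) ^ e)⁻¹) * ((ℓ : ℝ) ^ 2)⁻¹ := by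
    rw [← tsum_mul_right]
    refine hsum2.tsum_le_tsum (fun e ↦ ?_) ((summable_add_three_pow_div D).mul_right _)
    have h1 := hbd ℓ (e + 2) hℓ
    have h2 := hpow (ℓ ^ (e + 2)) (Nat.one_le_pow _ _ hℓ.pos)
    push_cast at h1 h2 ⊢
    calc _ ≤ ((e : ℝ) + 2 + 1) ^ D * ((ℓ : ℝ) ^ (e + 2))⁻¹ :=
          mul_le_mul h1 h2 (by positivity) (by positivity)
      _ = ((e : ℝ) + 3) ^ D * ((ℓ : ℝ) ^ e)⁻¹ * ((ℓ : ℝ) ^ 2)⁻¹ := by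
          rw [pow_add, mul_inv]; ring
      _ ≤ _ := by gcongr
  have hxle : f ℓ * (ℓ : ℝ) ^ (-s) ≤ 2 ^ D * (ℓ : ℝ)⁻¹ := by
    have h1 := hbd ℓ 1 hℓ
    rw [pow_one] at h1
    norm_num at h1
    exact mul_le_mul h1 (hpow ℓ hℓ.one_le) (by positivity) (by positivity)
  rw [← hsplit]
  refine ⟨by linarith, (Real.abs_log_one_add_add_sub_le hx hy).trans ?_⟩
  rw [eulerBound, add_mul]
  refine add_le_add ?_ hyle
  rw [← inv_pow, ← mul_pow]
  gcongr

theorem abs_log_tsum_sub_tsum_primes_le (hf1 : f 1 = 1) (hnn : ∀ n, 0 ≤ f n)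
    (hmul : ∀ m n : ℕ, m.Coprime n → f (m * n) = f m * f n)
    (hbd : ∀ ℓ e : ℕ, ℓ.Prime → f (ℓ ^ e) ≤ (e + 1) ^ D) {s : ℝ} (hs : 1 < s)
    (hsum : Summable fun n : ℕ ↦ f n * (n : ℝ) ^ (-s)) :
    |Real.log (∑' n : ℕ, f n * (n : ℝ) ^ (-s)) -
      ∑' ℓ : Nat.Primes, f ℓ * ((ℓ : ℕ) : ℝ) ^ (-s)| ≤
      eulerBound D * ∑' ℓ : Nat.Primes, (((ℓ : ℕ) : ℝ) ^ 2)⁻¹ := by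
  have hprod := EulerProduct.eulerProduct_hasProd (f := fun n : ℕ ↦ f n * (n : ℝ) ^ (-s))
    (by simp [hf1]) (fun {m n} h ↦ by
      simp only [hmul m n h, Nat.cast_mul]
      rw [Real.mul_rpow (by positivity) (by positivity)]
      ring) hsum.norm (by simp [Real.zero_rpow (show -s ≠ 0 by linarith)])
  have hfac := fun ℓ : Nat.Primes ↦ abs_log_eulerFactor_sub_le hf1 hnn hbd hs ℓ.2
    (hsum.comp_injective (Nat.pow_right_injective ℓ.2.two_le))
  have hpos : 0 < ∑' n : ℕ, f n * (n : ℝ) ^ (-s) := by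
    refine hsum.tsum_pos (fun n ↦ mul_nonneg (hnn _) (by positivity)) 1 (by simp [hf1])
  have hlog := hasSum_log_of_hasProd (fun ℓ ↦ (zero_lt_one.trans_le (hfac ℓ).1).ne')
    hpos.ne' hprod
  have hsP : Summable fun ℓ : Nat.Primes ↦ f ℓ * ((ℓ : ℕ) : ℝ) ^ (-s) :=
    hsum.comp_injective Subtype.val_injective
  rw [← hlog.tsum_eq, ← hlog.summable.tsum_sub hsP, ← tsum_mul_left, ← Real.norm_eq_abs]
  refine tsum_of_norm_bounded (summable_primes_sq_inv.mul_left _).hasSum fun ℓ ↦ ?_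
  exact (hfac ℓ).2

theorem tendsto_tsum_primes_div_log {c : ℝ} (hc : 0 < c) (hf1 : f 1 = 1) (hnn : ∀ n, 0 ≤ f n)
    (hmul : ∀ m n : ℕ, m.Coprime n → f (m * n) = f m * f n)
    (hbd : ∀ ℓ e : ℕ, ℓ.Prime → f (ℓ ^ e) ≤ (e + 1) ^ D)
    (hsum : ∀ s : ℝ, 1 < s → Summable fun n : ℕ ↦ f n * (n : ℝ) ^ (-s))
    (hres : Tendsto (fun s : ℝ ↦ (s - 1) * ∑' n : ℕ, f n * (n : ℝ) ^ (-s)) (𝓝[>] 1) (𝓝 c)) :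
    Tendsto (fun s : ℝ ↦ (∑' ℓ : Nat.Primes, f ℓ * ((ℓ : ℕ) : ℝ) ^ (-s)) / -Real.log (s - 1))
      (𝓝[>] 1) (𝓝 1) := by
  have hΛ := tendsto_neg_log_sub_one_atTop
  have h1 : Tendsto (fun s : ℝ ↦ Real.log ((s - 1) * ∑' n : ℕ, f n * (n : ℝ) ^ (-s)) /
      -Real.log (s - 1)) (𝓝[>] 1) (𝓝 0) :=
    (hres.log hc.ne').div_atTop hΛ
  have h2 : Tendsto (fun s : ℝ ↦ (Real.log (∑' n : ℕ, f n * (n : ℝ) ^ (-s)) -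
      ∑' ℓ : Nat.Primes, f ℓ * ((ℓ : ℕ) : ℝ) ^ (-s)) / -Real.log (s - 1)) (𝓝[>] 1) (𝓝 0) := by
    refine bdd_le_mul_tendsto_zero' (eulerBound D * ∑' ℓ : Nat.Primes, (((ℓ : ℕ) : ℝ) ^ 2)⁻¹)
      ?_ hΛ.inv_tendsto_atTop
    filter_upwards [self_mem_nhdsWithin] with s hs
    exact abs_log_tsum_sub_tsum_primes_le hf1 hnn hmul hbd hs (hsum s hs)
  have h3 := (h1.sub h2).add_const 1
  rw [sub_zero, zero_add] at h3
  refine h3.congr' ?_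
  filter_upwards [self_mem_nhdsWithin, hΛ.eventually_gt_atTop 0] with s hs hpos
  have hF : 0 < ∑' n : ℕ, f n * (n : ℝ) ^ (-s) :=
    (hsum s hs).tsum_pos (fun n ↦ mul_nonneg (hnn _) (by positivity)) 1 (by simp [hf1])
  rw [Real.log_mul (sub_pos.mpr (Set.mem_Ioi.mp hs)).ne' hF.ne']
  have hne : Real.log (s - 1) ≠ 0 := (neg_pos.mp hpos).ne
  field_simp
  ring

end

end

section

open NumberField UniqueFactorizationMonoid

section

variable {S : Type*} [CommRing S] [IsDedekindDomain S] [Module.Free ℤ S]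

theorem Ideal.card_normalizedFactors_le_of_absNorm_eq_pow {ℓ e : ℕ} (hℓ : ℓ.Prime)
    {I : Ideal S} (hI : absNorm I = ℓ ^ e) : Multiset.card (normalizedFactors I) ≤ e := by
  have hI0 : I ≠ 0 := by
    rintro rfl
    simp [eq_comm, hℓ.ne_zero] at hI
  have h1 : ∀ P ∈ normalizedFactors I, ℓ ∣ absNorm P := fun P hP ↦ by
    have hdvd : absNorm P ∣ ℓ ^ e := hI ▸ map_dvd absNorm (dvd_of_mem_normalizedFactors hP)
    obtain ⟨j, -, hj⟩ := (Nat.dvd_prime_pow hℓ).mp hdvd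
    rcases j with _ | j
    · rw [pow_zero, absNorm_eq_one_iff] at hj
      exact absurd hj (isPrime_of_prime (prime_of_normalized_factor P hP)).ne_top
    · exact hj ▸ dvd_pow_self ℓ j.succ_ne_zero
  have h2 : ℓ ^ Multiset.card (normalizedFactors I) ∣ ℓ ^ e := by
    rw [← hI]
    conv_rhs => rw [← associated_iff_eq.mp (prod_normalizedFactors hI0)]
    rw [map_multiset_prod, ← Multiset.prod_replicate, ← Multiset.map_const']
    exact Multiset.prod_dvd_prod_of_dvd _ _ h1
  exact (Nat.pow_dvd_pow_iff_le_right hℓ.one_lt).mp h2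

theorem Ideal.mul_sup_span_absNorm {m n : ℕ} (hmn : m.Coprime n) {J J' : Ideal S}
    (hJ : absNorm J = m) (hJ' : absNorm J' = n) : J * J' ⊔ span {(m : S)} = J := by
  have h1 : span {(m : S)} ≤ J := by
    rw [span_singleton_le_iff_mem, ← hJ]; exact absNorm_mem J
  have h2 : J' ⊔ span {(m : S)} = ⊤ := by
    rw [eq_top_iff_one]
    obtain ⟨a, b, hab⟩ := (Nat.isCoprime_iff_coprime.mpr hmn)
    have : (1 : S) = b * n + a * m := by
      have := congrArg (Int.cast : ℤ → S) hab
      push_cast at this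
      rw [← this, add_comm]
    rw [this]
    exact add_mem (mem_sup_left (J'.mul_mem_left _ (hJ' ▸ absNorm_mem J')))
      (mem_sup_right (mul_mem_left _ _ (mem_span_singleton_self _)))
  refine le_antisymm (sup_le mul_le_left h1) ?_
  calc J = J * (J' ⊔ span {(m : S)}) := by rw [h2, mul_top]
    _ = J * J' ⊔ J * span {(m : S)} := mul_sup _ _ _
    _ ≤ _ := sup_le_sup_left mul_le_right _

theorem Ideal.sup_span_mul_sup_span {m n : ℕ} (hmn : m.Coprime n) {I : Ideal S}
    (hI : absNorm I = m * n) : (I ⊔ span {(m : S)}) * (I ⊔ span {(n : S)}) = I := by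
  have hmem : span {(m : S)} * span {(n : S)} ≤ I := by
    rw [span_singleton_mul_span_singleton, span_singleton_le_iff_mem, ← Nat.cast_mul, ← hI]
    exact absNorm_mem I
  have h2 : span {(m : S)} ⊔ span {(n : S)} = ⊤ := by
    rw [eq_top_iff_one]
    obtain ⟨a, b, hab⟩ := (Nat.isCoprime_iff_coprime.mpr hmn)
    have : (1 : S) = a * m + b * n := by
      have := congrArg (Int.cast : ℤ → S) hab
      push_cast at this
      rw [← this]
    rw [this]
    exact add_mem (mem_sup_left (mul_mem_left _ _ (mem_span_singleton_self _)))
      (mem_sup_right (mul_mem_left _ _ (mem_span_singleton_self _)))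
  refine le_antisymm ?_ ?_
  · rw [sup_mul, mul_sup, mul_sup]
    exact sup_le (sup_le mul_le_left mul_le_left) (sup_le mul_le_right hmem)
  · calc I = I * (span {(m : S)} ⊔ span {(n : S)}) := by rw [h2, mul_top]
      _ ≤ _ := by
        rw [mul_sup]
        refine sup_le ?_ ?_
        · rw [mul_comm]
          exact mul_mono le_sup_right le_sup_left
        · exact mul_mono le_sup_left le_sup_right

theorem Ideal.card_absNorm_eq_one : Nat.card {I : Ideal S // absNorm I = 1} = 1 := by
  simp [absNorm_eq_one_iff]

variable [Module.Finite ℤ S]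

theorem Ideal.absNorm_sup_span_dvd {m n : ℕ} (hmn : m.Coprime n) {I : Ideal S}
    (hI : absNorm I = m * n) : absNorm (I ⊔ span {(m : S)}) ∣ m := by
  have h1 : absNorm (I ⊔ span {(m : S)}) ∣ m * n := hI ▸ absNorm_dvd_absNorm_of_le le_sup_left
  have h2 : absNorm (I ⊔ span {(m : S)}) ∣ m ^ Module.finrank ℤ S := by
    rw [← absNorm_span_natCast]; exact absNorm_dvd_absNorm_of_le le_sup_right
  exact (Nat.Coprime.coprime_dvd_left h2 (hmn.pow_left _)).dvd_of_dvd_mul_right h1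

theorem Ideal.card_absNorm_eq_mul {m n : ℕ} (hmn : m.Coprime n) :
    Nat.card {I : Ideal S // absNorm I = m * n} =
      Nat.card {I : Ideal S // absNorm I = m} * Nat.card {I : Ideal S // absNorm I = n} := by
  rcases eq_or_ne m 0 with rfl | hm
  · obtain rfl : n = 1 := by simpa using hmn
    rw [card_absNorm_eq_one, mul_one, mul_one]
  rcases eq_or_ne n 0 with rfl | hn
  · obtain rfl : m = 1 := by simpa using hmn
    rw [card_absNorm_eq_one, one_mul, one_mul]
  rw [← Nat.card_prod]
  refine (Nat.card_eq_of_bijective (fun x ↦ ⟨x.1.1 * x.2.1, by rw [map_mul, x.1.2, x.2.2]⟩)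
    ⟨?_, ?_⟩).symm
  · rintro ⟨⟨J, hJ⟩, ⟨J', hJ'⟩⟩ ⟨⟨K, hK⟩, ⟨K', hK'⟩⟩ h
    have h : J * J' = K * K' := congrArg Subtype.val h
    have h1 := mul_sup_span_absNorm hmn hJ hJ'
    have h2 := mul_sup_span_absNorm hmn.symm hJ' hJ
    rw [h, mul_sup_span_absNorm hmn hK hK'] at h1
    rw [mul_comm, h, mul_comm, mul_sup_span_absNorm hmn.symm hK' hK] at h2
    subst h1 h2
    rfl
  · rintro ⟨I, hI⟩
    have h := sup_span_mul_sup_span hmn hI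
    have h1 := absNorm_sup_span_dvd hmn hI
    have h2 := absNorm_sup_span_dvd hmn.symm (by rw [hI, mul_comm])
    have h3 := congrArg absNorm h
    rw [map_mul, hI] at h3
    obtain ⟨h4, h5⟩ := (mul_eq_mul_iff_eq_and_eq_of_pos' (Nat.le_of_dvd (Nat.pos_of_ne_zero hm) h1)
      (Nat.le_of_dvd (Nat.pos_of_ne_zero hn) h2) (Nat.pos_of_ne_zero hm)
        (Nat.pos_of_ne_zero fun h0 ↦ by
          rw [h0, mul_zero] at h3
          exact mul_ne_zero hm hn h3.symm)).mp h3
    exact ⟨⟨⟨_, h4⟩, ⟨_, h5⟩⟩, Subtype.ext h⟩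

variable [CharZero S]

instance Ideal.finite_absNorm_eq (n : ℕ) : _root_.Finite {I : Ideal S // absNorm I = n} :=
  (Ideal.finite_setOfPred_absNorm_eq n).to_subtype

theorem Ideal.card_absNorm_eq_prime_pow_le {ℓ : ℕ} (hℓ : ℓ.Prime) (e : ℕ) :
    Nat.card {I : Ideal S // absNorm I = ℓ ^ e} ≤ (e + 1) ^ Module.finrank ℤ S := by
  classical
  set F := (normalizedFactors (span {(ℓ : S)})).toFinset with hF
  have hℓ0 : span {(ℓ : S)} ≠ ⊥ := by simp [hℓ.ne_zero]
  have hFc : F.card ≤ Module.finrank ℤ S :=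
    (Multiset.toFinset_card_le _).trans
      (card_normalizedFactors_le_of_absNorm_eq_pow hℓ (absNorm_span_natCast ℓ))
  have hI0 : ∀ I : {I : Ideal S // absNorm I = ℓ ^ e}, I.1 ≠ 0 := by
    rintro ⟨I, hI⟩ rfl
    simp [eq_comm, hℓ.ne_zero] at hI
  have hmem : ∀ I : {I : Ideal S // absNorm I = ℓ ^ e}, ∀ P ∈ normalizedFactors I.1, P ∈ F := by
    intro I P hP
    obtain ⟨hprime, hle⟩ := (Ideal.mem_normalizedFactors_iff (hI0 I)).mp hP
    rw [hF, Multiset.mem_toFinset, Ideal.mem_normalizedFactors_iff hℓ0]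
    refine ⟨hprime, ?_⟩
    rw [span_singleton_le_iff_mem]
    have := hle (absNorm_mem I.1)
    rw [I.2, Nat.cast_pow] at this
    exact hprime.mem_of_pow_mem _ this
  let g : {I : Ideal S // absNorm I = ℓ ^ e} → F → Fin (e + 1) := fun I P ↦
    ⟨(normalizedFactors I.1).count P.1, Nat.lt_succ_of_le ((Multiset.count_le_card _ _).trans
      (card_normalizedFactors_le_of_absNorm_eq_pow hℓ I.2))⟩
  have hg : Function.Injective g := by
    intro I J h
    apply Subtype.ext
    rw [← associated_iff_eq, associated_iff_normalizedFactors_eq_normalizedFactors (hI0 I) (hI0 J)]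
    ext P
    by_cases hP : P ∈ F
    · exact congrArg Fin.val (congrFun h ⟨P, hP⟩)
    · rw [Multiset.count_eq_zero.mpr fun h ↦ hP (hmem I P h),
        Multiset.count_eq_zero.mpr fun h ↦ hP (hmem J P h)]
  calc _ ≤ Nat.card (F → Fin (e + 1)) := Nat.card_le_card_of_injective g hg
    _ = (e + 1) ^ F.card := by simp
    _ ≤ _ := Nat.pow_le_pow_right e.succ_pos hFc

end

section

open Filter Topology Asymptotics

variable (K : Type*) [Field K] [NumberField K]

theorem NumberField.sum_card_absNorm_eq (n : ℕ) :
    ∑ i ∈ Finset.Icc 1 n, Nat.card {I : Ideal (𝓞 K) // Ideal.absNorm I = i} =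
      Nat.card {I : nonZeroDivisors (Ideal (𝓞 K)) // Ideal.absNorm (I : Ideal (𝓞 K)) ≤ n} := by
  symm
  rw [← add_left_inj 1, ← Ideal.card_norm_le_eq_card_norm_le_add_one,
    show Finset.Icc 1 n = Finset.Ioc 0 n from Finset.Icc_succ_left_eq_Ioc _ _,
    show 1 = Nat.card {I : Ideal (𝓞 K) // Ideal.absNorm I = 0} by simp [Ideal.absNorm_eq_zero_iff],
    Finset.sum_Ioc_add_eq_sum_Icc (n.zero_le),
    ← Finset.card_preimage_eq_sum_card_image_eq (fun k _ ↦ Ideal.finite_setOfPred_absNorm_eq k)]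
  simp [Set.coe_eq_subtype]

theorem NumberField.LSeries_term_card_absNorm {s : ℝ} (hs : 1 < s) (n : ℕ) :
    LSeries.term (fun n ↦ (Nat.card {I : Ideal (𝓞 K) // Ideal.absNorm I = n} : ℂ)) s n =
      ((Nat.card {I : Ideal (𝓞 K) // Ideal.absNorm I = n} * (n : ℝ) ^ (-s) : ℝ) : ℂ) := by
  rw [LSeries.term]
  split_ifs with h
  · subst h
    simp [Real.zero_rpow (show -s ≠ 0 by linarith)]
  · rw [Complex.ofReal_mul, Complex.ofReal_cpow n.cast_nonneg]
    simp [Complex.cpow_neg, div_eq_mul_inv]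

theorem NumberField.summable_card_absNorm {s : ℝ} (hs : 1 < s) : Summable fun n : ℕ ↦
    (Nat.card {I : Ideal (𝓞 K) // Ideal.absNorm I = n} : ℝ) * (n : ℝ) ^ (-s) := by
  have hlim := (Ideal.tendsto_norm_le_div_atTop₀ K).comp tendsto_natCast_atTop_atTop
  have hO : (fun n : ℕ ↦ ∑ i ∈ Finset.Icc 1 n,
      (Nat.card {I : Ideal (𝓞 K) // Ideal.absNorm I = i} : ℝ)) =O[atTop]
      fun n : ℕ ↦ (n : ℝ) ^ (1 : ℝ) := by
    have h1 := (hlim.isBigO_one ℝ).mul (isBigO_refl (fun n : ℕ ↦ (n : ℝ)) atTop)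
    refine h1.congr' ?_ ?_
    · filter_upwards [eventually_gt_atTop 0] with n hn
      have : (n : ℝ) ≠ 0 := by positivity
      rw [← Nat.cast_sum, NumberField.sum_card_absNorm_eq]
      simp only [Function.comp_apply, Nat.cast_le]
      field_simp
    · exact .of_forall fun n ↦ by simp
  have := LSeriesSummable_of_sum_norm_bigO_and_nonneg hO (fun _ ↦ Nat.cast_nonneg _) zero_le_one
    (s := (s : ℂ)) (by simpa using hs)
  rw [← Complex.summable_ofReal]
  refine Summable.congr this fun n ↦ ?_
  rw [← NumberField.LSeries_term_card_absNorm K hs]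
  simp

theorem NumberField.tendsto_sub_one_mul_tsum_card_absNorm :
    Tendsto (fun s : ℝ ↦ (s - 1) *
      ∑' n : ℕ, (Nat.card {I : Ideal (𝓞 K) // Ideal.absNorm I = n} : ℝ) * (n : ℝ) ^ (-s))
      (𝓝[>] 1) (𝓝 (dedekindZeta_residue K)) := by
  have h := (Complex.continuous_re.tendsto _).comp (tendsto_sub_one_mul_dedekindZeta_nhdsGT K)
  rw [Complex.ofReal_re] at h
  refine h.congr' ?_
  filter_upwards [self_mem_nhdsWithin] with s hs
  rw [Function.comp_apply, dedekindZeta, LSeries, tsum_congr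
    (NumberField.LSeries_term_card_absNorm K (Set.mem_Ioi.mp hs)), ← Complex.ofReal_tsum]
  norm_cast

end

end

section

open NumberField

theorem RingHom.exists_comp_smul_eq_of_free {A B G Ω : Type*} [CommRing A] [CommRing B]
    [Algebra A B] [Group G] [_root_.Finite G] [MulSemiringAction G B] [Algebra.IsInvariant A B G]
    [Field Ω] (ψ ψ' : B →+* Ω)
    (hagree : ∀ a : A, ψ (algebraMap A B a) = ψ' (algebraMap A B a))
    (hψ : ∀ g : G, (∀ x, ψ (g • x) = ψ x) → g = 1)
    (hψ' : ∀ g : G, (∀ x, ψ' (g • x) = ψ' x) → g = 1) :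
    ∃ g : G, ∀ x, ψ' x = ψ (g • x) := by
  classical
  by_contra! h
  cases nonempty_fintype G
  have aux : ∀ (χ : B →+* Ω), (∀ g : G, (∀ x, χ (g • x) = χ x) → g = 1) →
      ∀ g g' : G, (∀ x, χ (g • x) = χ (g' • x)) → g = g' := by
    intro χ hχ g g' hx
    have := hχ (g * g'⁻¹) fun x ↦ by rw [mul_smul, hx, smul_inv_smul]
    exact mul_inv_eq_one.mp this
  let w : (B →+* Ω) → G → (B →* Ω) := fun χ g ↦
    ((χ.comp (MulSemiringAction.toRingHom G B g) : B →+* Ω) : B →* Ω)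
  have hw : ∀ χ g x, w χ g x = χ (g • x) := fun χ g x ↦ rfl
  let v : G ⊕ G → (B →* Ω) := Sum.elim (w ψ) (w ψ')
  have hne : ∀ g g', w ψ g ≠ w ψ' g' := by
    intro g g' heq
    obtain ⟨x, hx⟩ := h (g * g'⁻¹)
    apply hx
    have := DFunLike.congr_fun heq (g'⁻¹ • x)
    rw [hw, hw, smul_inv_smul] at this
    rw [← this, mul_smul]
  have hinj : Function.Injective v := by
    rintro (g | g) (g' | g') heq
    · exact congrArg _ (aux ψ hψ g g' fun x ↦ DFunLike.congr_fun heq x)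
    · exact absurd heq (hne g g')
    · exact absurd heq.symm (hne g' g)
    · exact congrArg _ (aux ψ' hψ' g g' fun x ↦ DFunLike.congr_fun heq x)
  have hli := (linearIndependent_monoidHom B Ω).comp v hinj
  rw [Fintype.linearIndependent_iff] at hli
  have key := hli (Sum.elim (fun _ ↦ 1) (fun _ ↦ -1)) (by
    funext x
    obtain ⟨a, ha⟩ := Algebra.IsInvariant.isInvariant (A := A) (G := G) (∑ g : G, g • x)
      fun g ↦ by
        rw [Finset.smul_sum]
        exact Fintype.sum_equiv (Equiv.mulLeft g) _ _ fun g' ↦ by simp [mul_smul]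
    have h1 := hagree a
    rw [ha, map_sum, map_sum] at h1
    simp [v, hw, h1]) (Sum.inl 1)
  simp at key

theorem RingHom.isPrimitiveRoot_map {B Ω : Type*} [CommRing B] [IsDomain B] [Field Ω]
    (ψ : B →+* Ω) {ζ : B} {N : ℕ} (hN : (N : Ω) ≠ 0) (hζ : IsPrimitiveRoot ζ N) :
    IsPrimitiveRoot (ψ ζ) N := by
  have : NeZero (N : Ω) := ⟨hN⟩
  have hN0 : 0 < N := Nat.pos_of_ne_zero fun h ↦ hN (by simp [h])
  rw [← Polynomial.isRoot_cyclotomic_iff, ← Polynomial.map_cyclotomic N ψ]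
  exact (hζ.isRoot_cyclotomic hN0).map

theorem RingHom.injOn_roots {B Ω : Type*} [CommRing B] [IsDomain B] [Field Ω]
    (ψ : B →+* Ω) {ζ x y : B} {N : ℕ} (hN : (N : Ω) ≠ 0) (hζ : IsPrimitiveRoot ζ N)
    (hx : x ^ N = 1) (hy : y ^ N = 1) (h : ψ x = ψ y) : x = y := by
  have : NeZero N := ⟨fun h ↦ hN (by simp [h])⟩
  obtain ⟨i, hi, rfl⟩ := hζ.eq_pow_of_pow_eq_one hx
  obtain ⟨j, hj, rfl⟩ := hζ.eq_pow_of_pow_eq_one hy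
  rw [map_pow, map_pow] at h
  rw [(ψ.isPrimitiveRoot_map hN hζ).pow_inj hi hj h]

theorem RingHom.zmod_eq_intCast {B : Type*} [CommRing B] {ℓ : ℕ} (χ : B →+* ZMod ℓ) (x : B) :
    ∃ n : ℤ, χ x = n ∧ x - n ∈ RingHom.ker χ := by
  obtain ⟨n, hn⟩ := ZMod.intCast_surjective (χ x)
  exact ⟨n, hn.symm, by simp [RingHom.mem_ker, hn]⟩

theorem RingHom.zmod_ext_of_ker_le {B R : Type*} [CommRing B] [CommRing R] {ℓ : ℕ}
    (i : ZMod ℓ →+* R) (χ : B →+* ZMod ℓ) (ψ : B →+* R)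
    (h : RingHom.ker χ ≤ RingHom.ker ψ) : ψ = i.comp χ := by
  ext x
  obtain ⟨n, hn, hmem⟩ := χ.zmod_eq_intCast x
  have := h hmem
  rw [RingHom.mem_ker, map_sub, sub_eq_zero, map_intCast] at this
  simp [this, hn]

section

variable {M L Ω : Type*} [Field M] [Field L] [Algebra M L] [Field Ω] {ℓ : ℕ} [Fact ℓ.Prime]
  [Algebra (ZMod ℓ) Ω] {ζ : 𝓞 L} {N : ℕ}

theorem smul_eq_one_of_fixes [IsGalois M L] (hN : (N : Ω) ≠ 0) (hζ : IsPrimitiveRoot ζ N)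
    (hgen : ∀ g : Gal(L/M), g • ζ = ζ → g = 1) (ψ : 𝓞 L →+* Ω)
    (g : Gal(L/M)) (hg : ∀ x, ψ (g • x) = ψ x) : g = 1 :=
  hgen g <| ψ.injOn_roots hN hζ (by rw [← smul_pow', hζ.pow_eq_one, smul_one]) hζ.pow_eq_one (hg ζ)

variable (M L Ω ℓ) in
/-- The homomorphisms `𝓞 L → Ω` whose restriction to `𝓞 M` takes values in the prime field. -/
def homsOver : Type _ :=
  Σ χ : 𝓞 M →+* ZMod ℓ, {ψ : 𝓞 L →+* Ω //
    ψ.comp (algebraMap (𝓞 M) (𝓞 L)) = (algebraMap (ZMod ℓ) Ω).comp χ}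

variable (M L Ω ℓ) in
theorem homsOver_equiv : Nonempty (homsOver M L Ω ℓ ≃ {ψ : 𝓞 L →+* Ω // ∀ x : 𝓞 M,
    ψ (algebraMap (𝓞 M) (𝓞 L) x) ^ ℓ = ψ (algebraMap (𝓞 M) (𝓞 L) x)}) := by
  have hi := (algebraMap (ZMod ℓ) Ω).injective
  have : CharP Ω ℓ := charP_of_injective_algebraMap hi ℓ
  refine ⟨Equiv.ofBijective (fun a ↦ ⟨a.2.1, fun x ↦ ?_⟩) ⟨?_, ?_⟩⟩
  · have := DFunLike.congr_fun a.2.2 x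
    simp only [RingHom.comp_apply] at this
    rw [this, ← map_pow, ZMod.pow_card]
  · rintro ⟨χ, ψ, h⟩ ⟨χ', ψ', h'⟩ heq
    obtain rfl : ψ = ψ' := congrArg Subtype.val heq
    obtain rfl : χ = χ' := by
      ext x
      apply hi
      exact (DFunLike.congr_fun h x).symm.trans (DFunLike.congr_fun h' x)
    rfl
  · rintro ⟨ψ, hψ⟩
    have hr : ∀ x : 𝓞 M, ∃ y : ZMod ℓ,
        algebraMap (ZMod ℓ) Ω y = ψ (algebraMap (𝓞 M) (𝓞 L) x) := by
      intro x
      obtain ⟨n, hn⟩ := (mem_bot_iff_intCast ℓ Ω).mp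
        ((Subfield.mem_bot_iff_pow_eq_self (F := Ω) (p := ℓ)).mpr (hψ x))
      exact ⟨n, by rw [← hn, map_intCast]⟩
    choose y hy using hr
    let χ : 𝓞 M →+* ZMod ℓ :=
      { toFun := y
        map_one' := hi (by simp [hy])
        map_mul' := fun a b ↦ hi (by simp [hy])
        map_zero' := hi (by simp [hy])
        map_add' := fun a b ↦ hi (by simp [hy]) }
    exact ⟨⟨χ, ψ, RingHom.ext fun x ↦ (hy x).symm⟩, rfl⟩

variable [NumberField L]

theorem exists_extension_ringHom [IsAlgClosed Ω] (χ : 𝓞 M →+* ZMod ℓ) :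
    ∃ ψ : 𝓞 L →+* Ω, ψ.comp (algebraMap (𝓞 M) (𝓞 L)) = (algebraMap (ZMod ℓ) Ω).comp χ := by
  have hmax : (RingHom.ker χ).IsMaximal :=
    RingHom.ker_isMaximal_of_surjective χ (ZMod.ringHom_surjective χ)
  obtain ⟨Q, hQ, hQP⟩ := Ideal.exists_ideal_over_maximal_of_isIntegral (S := 𝓞 L)
    (RingHom.ker χ) (by
      rw [(RingHom.injective_iff_ker_eq_bot _).mp
        (FaithfulSMul.algebraMap_injective (𝓞 M) (𝓞 L))]
      exact bot_le)
  have hℓ : (ℓ : 𝓞 L) ∈ Q := by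
    have : (ℓ : 𝓞 M) ∈ RingHom.ker χ := by simp [RingHom.mem_ker]
    rw [← hQP] at this
    simpa using this
  let _ : Field (𝓞 L ⧸ Q) := Ideal.Quotient.field Q
  have hc : CharP (𝓞 L ⧸ Q) ℓ := by
    have h0 : ((ℓ : ℕ) : 𝓞 L ⧸ Q) = 0 := by
      rw [← map_natCast (Ideal.Quotient.mk Q), Ideal.Quotient.eq_zero_iff_mem]
      exact hℓ
    exact (CharP.charP_iff_prime_eq_zero Fact.out).mpr h0
  let _ : Algebra (ZMod ℓ) (𝓞 L ⧸ Q) := ZMod.algebra _ ℓ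
  have hQ0 : Q ≠ ⊥ := by
    rintro rfl
    simp at hℓ
    exact (Fact.out : ℓ.Prime).ne_zero hℓ
  have : Finite (𝓞 L ⧸ Q) := Ring.HasFiniteQuotients.finiteQuotient hQ0
  have : Module.Finite (ZMod ℓ) (𝓞 L ⧸ Q) := Module.Finite.of_finite
  let f : 𝓞 L ⧸ Q →ₐ[ZMod ℓ] Ω := IsAlgClosed.lift
  refine ⟨(f : 𝓞 L ⧸ Q →+* Ω).comp (Ideal.Quotient.mk Q), ?_⟩
  refine RingHom.zmod_ext_of_ker_le _ _ _ ?_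
  intro x hx
  rw [← hQP, Ideal.mem_comap] at hx
  rw [RingHom.mem_ker]
  simp [Ideal.Quotient.eq_zero_iff_mem.mpr hx]

variable [NumberField M]

theorem exists_galois_of_agree [IsGalois M L] (hN : (N : Ω) ≠ 0) (hζ : IsPrimitiveRoot ζ N)
    (hgen : ∀ g : Gal(L/M), g • ζ = ζ → g = 1) (ψ ψ' : 𝓞 L →+* Ω)
    (h : ψ.comp (algebraMap (𝓞 M) (𝓞 L)) = ψ'.comp (algebraMap (𝓞 M) (𝓞 L))) :
    ∃ g : Gal(L/M), ∀ x, ψ' x = ψ (g • x) :=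
  RingHom.exists_comp_smul_eq_of_free (A := 𝓞 M) ψ ψ' (fun a ↦ DFunLike.congr_fun h a)
    (smul_eq_one_of_fixes hN hζ hgen ψ) (smul_eq_one_of_fixes hN hζ hgen ψ')

theorem card_homsOver [IsAlgClosed Ω] [IsGalois M L] (hN : (N : Ω) ≠ 0) (hζ : IsPrimitiveRoot ζ N)
    (hgen : ∀ g : Gal(L/M), g • ζ = ζ → g = 1) :
    Nat.card (homsOver M L Ω ℓ) = Nat.card (𝓞 M →+* ZMod ℓ) * Nat.card Gal(L/M) := by
  have key : ∀ χ : 𝓞 M →+* ZMod ℓ, Nonempty ({ψ : 𝓞 L →+* Ω //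
      ψ.comp (algebraMap (𝓞 M) (𝓞 L)) = (algebraMap (ZMod ℓ) Ω).comp χ} ≃ Gal(L/M)) := by
    intro χ
    obtain ⟨ψ, hψ⟩ := exists_extension_ringHom (L := L) (Ω := Ω) χ
    have hs : ∀ g : Gal(L/M), (ψ.comp (MulSemiringAction.toRingHom _ (𝓞 L) g)).comp
        (algebraMap (𝓞 M) (𝓞 L)) = (algebraMap (ZMod ℓ) Ω).comp χ := by
      intro g
      rw [← hψ]
      ext x
      simp
    refine ⟨(Equiv.ofBijective (fun g ↦ ⟨_, hs g⟩) ⟨?_, ?_⟩).symm⟩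
    · intro g g' h
      have h' : ∀ x, ψ (g • x) = ψ (g' • x) := fun x ↦
        DFunLike.congr_fun (congrArg Subtype.val h) x
      refine mul_inv_eq_one.mp (smul_eq_one_of_fixes hN hζ hgen ψ (g * g'⁻¹) fun x ↦ ?_)
      rw [mul_smul, h', smul_inv_smul]
    · rintro ⟨ψ', hψ'⟩
      obtain ⟨g, hg⟩ := exists_galois_of_agree hN hζ hgen ψ ψ' (hψ.trans hψ'.symm)
      exact ⟨g, Subtype.ext (RingHom.ext fun x ↦ (hg x).symm)⟩
  rw [homsOver, Nat.card_congr (Equiv.sigmaCongrRight fun χ ↦ (key χ).some),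
    Nat.card_congr (Equiv.sigmaEquivProd _ _), Nat.card_prod]

end

section

variable {k L : Type*} [Field k] [NumberField k] [Field L] [NumberField L] [Algebra k L]
  {ℓ : ℕ} [Fact ℓ.Prime] {ζ : 𝓞 L} {N : ℕ}

theorem exists_frobenius_iff {M Ω : Type*} [Field M] [NumberField M] [Algebra M L] [IsGalois M L]
    [Field Ω] [CharP Ω ℓ] (hN : (N : Ω) ≠ 0) (hζ : IsPrimitiveRoot ζ N)
    (hgen : ∀ g : Gal(L/M), g • ζ = ζ → g = 1) (ψ : 𝓞 L →+* Ω)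
    (hψ : ∀ x : 𝓞 M, ψ (algebraMap (𝓞 M) (𝓞 L) x) ^ ℓ = ψ (algebraMap (𝓞 M) (𝓞 L) x)) :
    ∃ g : Gal(L/M), g • ζ = ζ ^ ℓ ∧ ∀ x, ψ x ^ ℓ = ψ (g • x) := by
  obtain ⟨g, hg⟩ := exists_galois_of_agree hN hζ hgen ψ ((frobenius Ω ℓ).comp ψ)
    (RingHom.ext fun x ↦ (hψ x).symm)
  refine ⟨g, ψ.injOn_roots hN hζ ?_ ?_ ?_, hg⟩
  · rw [← smul_pow', hζ.pow_eq_one, smul_one]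
  · rw [← pow_mul, mul_comm, pow_mul, hζ.pow_eq_one, one_pow]
  · rw [← hg, map_pow]; rfl

theorem card_ringHom_intermediateField [IsGalois k L] (hN : (N : ZMod ℓ) ≠ 0)
    (hζ : IsPrimitiveRoot ζ N) (hgen : ∀ g : Gal(L/k), g • ζ = ζ → g = 1)
    (M : IntermediateField k L) [Decidable (∃ g : Gal(L/M), g • ζ = ζ ^ ℓ)] :
    Nat.card (𝓞 M →+* ZMod ℓ) * Nat.card Gal(L/M) =
      if ∃ g : Gal(L/M), g • ζ = ζ ^ ℓ then
        Nat.card (𝓞 k →+* ZMod ℓ) * Nat.card Gal(L/k) else 0 := by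
  let Ω := AlgebraicClosure (ZMod ℓ)
  have hN' : (N : Ω) ≠ 0 := by
    rw [← map_natCast (algebraMap (ZMod ℓ) Ω)]
    exact (map_ne_zero _).mpr hN
  have hc : CharP Ω ℓ := charP_of_injective_algebraMap (algebraMap (ZMod ℓ) Ω).injective ℓ
  have hres : ∀ (g : Gal(L/M)) (x : 𝓞 L), (g.restrictScalars k) • x = g • x := fun g x ↦ rfl
  have hgen' : ∀ g : Gal(L/M), g • ζ = ζ → g = 1 := fun g hg ↦ by
    have := hgen (g.restrictScalars k) hg
    ext x
    exact DFunLike.congr_fun this x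
  rw [← card_homsOver (Ω := Ω) hN' hζ hgen', ← card_homsOver (Ω := Ω) hN' hζ hgen,
    Nat.card_congr (homsOver_equiv M L Ω ℓ).some, Nat.card_congr (homsOver_equiv k L Ω ℓ).some]
  split_ifs with h
  · refine Nat.card_congr (Equiv.subtypeEquivRight fun ψ ↦ ⟨fun hψ x ↦ ?_, fun hψ x ↦ ?_⟩)
    · exact hψ (algebraMap (𝓞 k) (𝓞 M) x)
    · obtain ⟨u, hu⟩ := h
      obtain ⟨g, hg, hg'⟩ := exists_frobenius_iff (M := k) hN' hζ hgen ψ hψ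
      have : (u.restrictScalars k)⁻¹ * g = 1 := hgen _ (by
        rw [mul_smul, hg, ← hu, ← hres, inv_smul_smul])
      have hgu : g = u.restrictScalars k := (inv_mul_eq_one.mp this).symm
      rw [hg', hgu, hres, smul_algebraMap]
  · rw [Nat.card_eq_zero]
    left
    rw [isEmpty_subtype]
    intro ψ hψ
    obtain ⟨g, hg, -⟩ := exists_frobenius_iff (M := M) hN' hζ hgen' ψ hψ
    exact h ⟨g, hg⟩

theorem card_ringHom_zmod_eq (M : Type*) [Field M] [NumberField M] :
    Nat.card (𝓞 M →+* ZMod ℓ) = Nat.card {I : Ideal (𝓞 M) // Ideal.absNorm I = ℓ} := by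
  have hℓ : ℓ.Prime := Fact.out
  have hnorm : ∀ χ : 𝓞 M →+* ZMod ℓ, Ideal.absNorm (RingHom.ker χ) = ℓ := fun χ ↦ by
    rw [Ideal.absNorm_apply, Submodule.cardQuot_apply]
    exact (Nat.card_congr (RingHom.quotientKerEquivOfSurjective
      (ZMod.ringHom_surjective χ)).toEquiv).trans (Nat.card_zmod ℓ)
  refine Nat.card_congr (Equiv.ofBijective (fun χ ↦ ⟨RingHom.ker χ, hnorm χ⟩) ⟨?_, ?_⟩)
  · intro χ χ' h
    have := RingHom.zmod_ext_of_ker_le (RingHom.id _) χ χ' (congrArg Subtype.val h).le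
    rw [this]; rfl
  · rintro ⟨I, hI⟩
    have hcard : Nat.card (𝓞 M ⧸ I) = ℓ := hI
    have : _root_.Finite (𝓞 M ⧸ I) := Nat.finite_of_card_ne_zero (hcard ▸ hℓ.ne_zero)
    have := Fintype.ofFinite (𝓞 M ⧸ I)
    let e := ZMod.ringEquivOfPrime (𝓞 M ⧸ I) hℓ (by rw [← Nat.card_eq_fintype_card, hcard])
    refine ⟨(e.symm : 𝓞 M ⧸ I →+* ZMod ℓ).comp (Ideal.Quotient.mk I), Subtype.ext ?_⟩
    ext x
    simp [RingHom.mem_ker, Ideal.Quotient.eq_zero_iff_mem]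

end

end

section

open Filter Topology

/-- The weight `w` on the primes has Dirichlet density `c`. -/
def HasPrimeDensity (w : ℕ → ℝ) (c : ℝ) : Prop :=
  (∀ s : ℝ, 1 < s → Summable fun ℓ : Nat.Primes ↦ w ℓ * ((ℓ : ℕ) : ℝ) ^ (-s)) ∧
  Tendsto (fun s : ℝ ↦ (∑' ℓ : Nat.Primes, w ℓ * ((ℓ : ℕ) : ℝ) ^ (-s)) / -Real.log (s - 1))
      (𝓝[>] 1) (𝓝 c)

namespace HasPrimeDensity

variable {v w : ℕ → ℝ} {c c' : ℝ}

theorem sub (hv : HasPrimeDensity v c) (hw : HasPrimeDensity w c') :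
    HasPrimeDensity (fun ℓ ↦ v ℓ - w ℓ) (c - c') := by
  refine ⟨fun s hs ↦ ?_, ?_⟩
  · simpa only [sub_mul] using (hv.1 s hs).sub (hw.1 s hs)
  · refine (hv.2.sub hw.2).congr' ?_
    filter_upwards [self_mem_nhdsWithin] with s hs
    simp only [sub_mul, (hv.1 s hs).tsum_sub (hw.1 s hs), sub_div]

theorem const_mul (a : ℝ) (hv : HasPrimeDensity v c) :
    HasPrimeDensity (fun ℓ ↦ a * v ℓ) (a * c) := by
  refine ⟨fun s hs ↦ ?_, ?_⟩
  · simpa only [mul_assoc] using (hv.1 s hs).mul_left a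
  · refine (hv.2.const_mul a).congr fun s ↦ ?_
    simp only [mul_assoc, tsum_mul_left, mul_div_assoc]

theorem of_finite (h : {ℓ : Nat.Primes | w ℓ ≠ 0}.Finite) : HasPrimeDensity w 0 := by
  have hz : ∀ s : ℝ, ∀ ℓ ∉ h.toFinset, w ℓ * ((ℓ : ℕ) : ℝ) ^ (-s) = 0 := by
    intro s ℓ hℓ
    rw [Set.Finite.mem_toFinset, Set.mem_ofPred_eq, not_not] at hℓ
    rw [hℓ, zero_mul]
  refine ⟨fun s hs ↦ summable_of_ne_finset_zero (hz s), ?_⟩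
  simp_rw [fun s : ℝ ↦ tsum_eq_sum (L := .unconditional _) (hz s)]
  refine Tendsto.div_atTop (a := ∑ ℓ ∈ h.toFinset, w ℓ * ((ℓ : ℕ) : ℝ) ^ (-(1 : ℝ))) ?_
    tendsto_neg_log_sub_one_atTop
  refine tendsto_finsetSum _ fun ℓ _ ↦ Tendsto.const_mul _ ?_
  have hℓ : ((ℓ : ℕ) : ℝ) ≠ 0 := by exact_mod_cast ℓ.2.ne_zero
  exact (((Real.continuous_const_rpow hℓ).comp continuous_neg).tendsto 1).mono_left
    nhdsWithin_le_nhds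

theorem zero : HasPrimeDensity 0 0 := of_finite (by simp)

theorem add (hv : HasPrimeDensity v c) (hw : HasPrimeDensity w c') :
    HasPrimeDensity (fun ℓ ↦ v ℓ + w ℓ) (c + c') := by
  have := hv.sub (hw.const_mul (-1))
  simpa using this

theorem sum {ι : Type*} (s : Finset ι) {f : ι → ℕ → ℝ} {c : ι → ℝ}
    (h : ∀ i ∈ s, HasPrimeDensity (f i) (c i)) :
    HasPrimeDensity (fun ℓ ↦ ∑ i ∈ s, f i ℓ) (∑ i ∈ s, c i) := by
  classical
  induction s using Finset.induction_on with
  | empty => simpa using! zero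
  | insert a s ha ih =>
    simp only [Finset.sum_insert ha]
    exact (h a (s.mem_insert_self a)).add (ih fun i hi ↦ h i (Finset.mem_insert_of_mem hi))

theorem congr_of_finite (hv : HasPrimeDensity v c) (h : {ℓ : Nat.Primes | v ℓ ≠ w ℓ}.Finite) :
    HasPrimeDensity w c := by
  have := hv.sub (of_finite (w := fun ℓ ↦ v ℓ - w ℓ) (h.subset fun ℓ hℓ ↦ sub_ne_zero.mp hℓ))
  simpa using this

theorem unique (hv : HasPrimeDensity v c) (hv' : HasPrimeDensity v c') : c = c' :=
  tendsto_nhds_unique hv.2 hv'.2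

theorem infinite (hv : HasPrimeDensity v c) (hc : c ≠ 0) : {ℓ : Nat.Primes | v ℓ ≠ 0}.Infinite :=
  fun h ↦ hc (hv.unique (of_finite h))

theorem zpowers_eq {Γ : Type*} [Group Γ] [Fintype Γ] [DecidableEq (Subgroup Γ)]
    [∀ H : Subgroup Γ, DecidablePred (· ∈ H)] {a : ℕ → Γ → ℝ} {r : ℝ}
    (ha : ∀ H : Subgroup Γ, HasPrimeDensity (fun ℓ ↦ ∑ g with g ∈ H, a ℓ g)
      (∑ g : Γ with g ∈ H, r)) (U : Subgroup Γ) :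
    HasPrimeDensity (fun ℓ ↦ ∑ g with Subgroup.zpowers g = U, a ℓ g)
      (∑ g : Γ with Subgroup.zpowers g = U, r) := by
  classical
  cases nonempty_fintype (Subgroup Γ)
  induction U using WellFoundedLT.induction with
  | ind U ih =>
    have key : ∀ f : Γ → ℝ, ∑ g with Subgroup.zpowers g = U, f g = ∑ g with g ∈ U, f g -
        ∑ V with V < U, ∑ g with Subgroup.zpowers g = V, f g := by
      intro f
      rw [eq_sub_iff_add_eq, ← Finset.sum_biUnion, ← Finset.sum_union]
      · congr 1
        ext g
        simp only [Finset.mem_union, Finset.mem_filter, Finset.mem_univ, true_and,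
          Finset.mem_biUnion]
        rw [← Subgroup.zpowers_le, le_iff_eq_or_lt]
        simp
      · rw [Finset.disjoint_left]
        intro g hg
        simp only [Finset.mem_filter, Finset.mem_univ, true_and, Finset.mem_biUnion] at hg ⊢
        rintro ⟨V, hV, h⟩
        exact hV.ne (h ▸ hg)
      · intro V _ V' _ hne
        rw [Function.onFun, Finset.disjoint_left]
        intro g hg hg'
        simp only [Finset.mem_filter, Finset.mem_univ, true_and] at hg hg'
        exact hne (hg.symm.trans hg')
    simp only [fun ℓ ↦ key (a ℓ), key fun _ ↦ r]
    exact (ha U).sub (sum _ fun V hV ↦ ih V (by simpa using hV))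

end HasPrimeDensity

end

section

variable {k L : Type*} [Field k] [NumberField k] [Field L] [NumberField L] [Algebra k L]

open NumberField

variable (k) in
theorem NumberField.hasPrimeDensity_card_absNorm : HasPrimeDensity
    (fun ℓ ↦ (Nat.card {I : Ideal (𝓞 k) // Ideal.absNorm I = ℓ} : ℝ)) 1 :=
  ⟨fun s hs ↦ (NumberField.summable_card_absNorm k hs).comp_injective Subtype.val_injective,
    tendsto_tsum_primes_div_log (f := fun n ↦
        (Nat.card {I : Ideal (𝓞 k) // Ideal.absNorm I = n} : ℝ))
      (D := Module.finrank ℤ (𝓞 k)) (dedekindZeta_residue_pos k)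
      (by simp only [Ideal.card_absNorm_eq_one, Nat.cast_one]) (fun _ ↦ Nat.cast_nonneg _)
      (fun m n hmn ↦ by
        rw [Ideal.card_absNorm_eq_mul hmn, Nat.cast_mul])
      (fun ℓ e hℓ ↦ by exact_mod_cast Ideal.card_absNorm_eq_prime_pow_le hℓ e)
      (fun s hs ↦ NumberField.summable_card_absNorm k hs)
      (NumberField.tendsto_sub_one_mul_tsum_card_absNorm k)⟩

open Classical in
theorem hasPrimeDensity_subgroup [IsGalois k L] {N : ℕ} (hN : N ≠ 0) {ζ : 𝓞 L}
    (hζ : IsPrimitiveRoot ζ N) (hgen : ∀ g : Gal(L/k), g • ζ = ζ → g = 1)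
    (H : Subgroup Gal(L/k)) :
    HasPrimeDensity (fun ℓ ↦ ∑ g with g ∈ H,
      if g • ζ = ζ ^ ℓ then (Nat.card {I : Ideal (𝓞 k) // Ideal.absNorm I = ℓ} : ℝ) else 0)
      (∑ g : Gal(L/k) with g ∈ H, (Nat.card Gal(L/k) : ℝ)⁻¹) := by
  let M := IntermediateField.fixedField H
  have hH : M.fixingSubgroup = H := IntermediateField.fixingSubgroup_fixedField H
  have hM := (NumberField.hasPrimeDensity_card_absNorm M).const_mul
    ((Nat.card H : ℝ) / Nat.card Gal(L/k))
  have hc : ∑ g : Gal(L/k) with g ∈ H, (Nat.card Gal(L/k) : ℝ)⁻¹ =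
      (Nat.card H : ℝ) / Nat.card Gal(L/k) * 1 := by
    rw [Finset.sum_const, nsmul_eq_mul, mul_one, div_eq_mul_inv, Nat.card_eq_fintype_card (α := H),
      Fintype.card_subtype]
  rw [hc]
  refine hM.congr_of_finite ?_
  refine ((N.primeFactors.finite_toSet.preimage Subtype.val_injective.injOn).subset ?_)
  intro ℓ hℓ
  by_contra hmem
  apply hℓ
  have : Fact (ℓ : ℕ).Prime := ⟨ℓ.2⟩
  have hNℓ : (N : ZMod ℓ) ≠ 0 := by
    rw [Ne, ZMod.natCast_eq_zero_iff]
    intro hdvd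
    exact hmem (Nat.mem_primeFactors.mpr ⟨ℓ.2, hdvd, hN⟩)
  have h1 := card_ringHom_intermediateField hNℓ hζ hgen M
  rw [card_ringHom_zmod_eq, card_ringHom_zmod_eq] at h1
  have e : Gal(L/M) ≃* H := (IntermediateField.fixingSubgroupEquiv M).symm.trans
    (MulEquiv.subgroupCongr hH)
  have h2 : (∃ g : Gal(L/M), g • ζ = ζ ^ (ℓ : ℕ)) ↔ ∃ g ∈ H, g • ζ = ζ ^ (ℓ : ℕ) := by
    constructor
    · rintro ⟨g, hg⟩
      refine ⟨g.restrictScalars k, ?_, hg⟩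
      rw [← hH, IntermediateField.mem_fixingSubgroup_iff]
      exact fun x hx ↦ g.commutes ⟨x, hx⟩
    · rintro ⟨g, hg, hgζ⟩
      rw [← hH] at hg
      exact ⟨IntermediateField.fixingSubgroupEquiv M ⟨g, hg⟩, hgζ⟩
  have hΓ : (Nat.card Gal(L/k) : ℝ) ≠ 0 := by exact_mod_cast Nat.card_pos.ne'
  rw [Nat.card_congr e.toEquiv] at h1
  have h3 : (Nat.card {I : Ideal (𝓞 M) // Ideal.absNorm I = (ℓ : ℕ)} : ℝ) * Nat.card H =
      (if ∃ g ∈ H, g • ζ = ζ ^ (ℓ : ℕ) then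
        (Nat.card {I : Ideal (𝓞 k) // Ideal.absNorm I = (ℓ : ℕ)} : ℝ) else 0) *
        Nat.card Gal(L/k) := by
    have := congrArg (Nat.cast : ℕ → ℝ) h1
    simp only [h2] at this
    split_ifs at this ⊢ <;> simpa using this
  rw [div_mul_eq_mul_div, mul_comm, h3, mul_div_cancel_right₀ _ hΓ]
  split_ifs with h
  · obtain ⟨g, hg, hgζ⟩ := h
    rw [Finset.sum_eq_single_of_mem g (by simpa using hg), if_pos hgζ]
    intro g' _ hne
    rw [if_neg]
    intro hg'
    apply hne
    rw [← inv_mul_eq_one.mp (hgen (g⁻¹ * g') (by rw [mul_smul, hg', ← hgζ, inv_smul_smul]))]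
  · refine (Finset.sum_eq_zero fun g hg ↦ if_neg fun hgζ ↦ h ⟨g, ?_, hgζ⟩).symm
    simpa using hg

theorem exists_prime_gt_zpowers_eq_top [IsGalois k L] [IsCyclic Gal(L/k)] {N : ℕ} (hN : N ≠ 0)
    {ζ : 𝓞 L} (hζ : IsPrimitiveRoot ζ N) (hgen : ∀ g : Gal(L/k), g • ζ = ζ → g = 1) (B : ℕ) :
    ∃ ℓ : ℕ, ℓ.Prime ∧ B < ℓ ∧ Nonempty (𝓞 k →+* ZMod ℓ) ∧
      ∃ g : Gal(L/k), g • ζ = ζ ^ ℓ ∧ Subgroup.zpowers g = ⊤ := by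
  classical
  have h := HasPrimeDensity.zpowers_eq (hasPrimeDensity_subgroup hN hζ hgen) ⊤
  have hinf := h.infinite (by
    obtain ⟨g, hg⟩ := IsCyclic.exists_generator (α := Gal(L/k))
    refine (Finset.sum_pos (fun _ _ ↦ ?_) ⟨g, ?_⟩).ne'
    · have : 0 < Nat.card Gal(L/k) := Nat.card_pos
      positivity
    · simpa using (Subgroup.eq_top_iff' _).mpr hg)
  have hinf' := hinf.image (Subtype.val_injective (p := Nat.Prime)).injOn
  obtain ⟨_, ⟨ℓ, hℓ, rfl⟩, hB⟩ := hinf'.exists_gt B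
  have : Fact (ℓ : ℕ).Prime := ⟨ℓ.2⟩
  obtain ⟨g, hg, hne⟩ := Finset.exists_ne_zero_of_sum_ne_zero hℓ
  rw [ite_ne_right_iff] at hne
  refine ⟨ℓ, ℓ.2, hB, ?_, g, hne.1, by simpa using hg⟩
  have h0 := hne.2
  rw [← card_ringHom_zmod_eq] at h0
  exact (Nat.card_ne_zero.mp (by exact_mod_cast h0)).1

end

section

open NumberField

theorem MulEquiv.pow_apply_of_apply_eq_pow {Γ B : Type*} [Group Γ] [CommRing B]
    [MulSemiringAction Γ B] {g : Γ} {ζ : B} {ℓ : ℕ} (hg : g • ζ = ζ ^ ℓ) (j : ℕ) :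
    (g ^ j) • ζ = ζ ^ ℓ ^ j := by
  induction j with
  | zero => simp
  | succ j ih => rw [pow_succ', mul_smul, ih, smul_pow', hg, ← pow_mul, pow_succ']

variable {k L : Type*} [Field k] [NumberField k] [Field L] [NumberField L] [Algebra k L]

theorem exists_fixedField_primitiveRoot [IsGalois k L] {p n ℓ : ℕ} (hp : p.Prime) (hℓ : ℓ.Prime)
    (hn : n ≠ 0)
    (hpℓ : p < ℓ) (hk : Module.finrank ℚ k < p ^ (n - 1)) {ζ : 𝓞 L}
    (hζ : IsPrimitiveRoot ζ (p ^ n)) (hgen : ∀ g : Gal(L/k), g • ζ = ζ → g = 1)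
    {g : Gal(L/k)} (hg : g • ζ = ζ ^ ℓ) (htop : Subgroup.zpowers g = ⊤) :
    ∃ E : IntermediateField k L, Module.finrank k E = orderOf (ℓ : ZMod p) ∧
      ∃ ξ : E, IsPrimitiveRoot ξ (p ^ padicValNat p (ℓ ^ orderOf (ℓ : ZMod p) - 1)) := by
  have : Fact p.Prime := ⟨hp⟩
  have hpn : 0 < p ^ n := pow_pos hp.pos n
  set t := orderOf (ℓ : ZMod p) with ht_def
  have hℓp : (ℓ : ZMod p) ≠ 0 := by
    rw [Ne, ZMod.natCast_eq_zero_iff]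
    exact fun h ↦ hpℓ.ne ((Nat.prime_dvd_prime_iff_eq hp hℓ).mp h)
  have htp : t ∣ p - 1 := ZMod.orderOf_dvd_card_sub_one hℓp
  have ht0 : 0 < t := Nat.pos_of_dvd_of_pos htp (Nat.sub_pos_of_lt hp.one_lt)
  have hcard : orderOf g = Module.finrank k L := by
    rw [← IsGalois.card_aut_eq_finrank, ← Nat.card_zpowers, htop, Subgroup.card_top]
  have hpow : ∀ j, ζ ^ ℓ ^ j = ζ ↔ p ^ n ∣ ℓ ^ j - 1 := fun j ↦ by
    have h1 : 1 ≤ ℓ ^ j := Nat.one_le_pow _ _ hℓ.pos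
    rw [← hζ.pow_eq_one_iff_dvd]
    conv_lhs => rw [← Nat.sub_add_cancel h1, pow_succ]
    have : ζ ≠ 0 := hζ.ne_zero hpn.ne'
    exact mul_eq_right₀ this
  have hgpow : ∀ j, g ^ j = 1 ↔ p ^ n ∣ ℓ ^ j - 1 := fun j ↦ by
    rw [← hpow, ← MulEquiv.pow_apply_of_apply_eq_pow hg]
    exact ⟨fun h ↦ by rw [h, one_smul], hgen _⟩
  have hmodp : ∀ j, p ∣ ℓ ^ j - 1 ↔ t ∣ j := fun j ↦ by
    rw [orderOf_dvd_iff_pow_eq_one, ← ZMod.natCast_eq_zero_iff,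
      Nat.cast_sub (Nat.one_le_pow _ _ hℓ.pos), sub_eq_zero]
    simp
  set m := padicValNat p (ℓ ^ t - 1) with hm_def
  have hne : ℓ ^ t - 1 ≠ 0 := (Nat.sub_pos_of_lt (Nat.one_lt_pow ht0.ne' hℓ.one_lt)).ne'
  have hmn : m ≤ n := by
    by_contra! hlt
    have h1 : g ^ t = 1 := (hgpow t).mpr ((padicValNat_dvd_iff_le hne).mpr hlt.le)
    have h2 : Module.finrank k L ≤ p - 1 := by
      rw [← hcard]
      exact Nat.le_of_dvd (Nat.sub_pos_of_lt hp.one_lt) ((orderOf_dvd_of_pow_eq_one h1).trans htp)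
    have h3 : Nat.totient (p ^ n) ≤ Module.finrank ℚ L := by
      have hζ' : IsPrimitiveRoot (algebraMap (𝓞 L) L ζ) (p ^ n) :=
        hζ.map_of_injective RingOfIntegers.coe_injective
      rw [← Polynomial.natDegree_cyclotomic (p ^ n) ℚ,
        Polynomial.cyclotomic_eq_minpoly_rat hζ' hpn]
      exact minpoly.natDegree_le _
    rw [Nat.totient_prime_pow hp (Nat.pos_of_ne_zero hn), ← Module.finrank_mul_finrank ℚ k L] at h3
    have h4 : 0 < p - 1 := Nat.sub_pos_of_lt hp.one_lt
    have := Nat.mul_le_mul_left (Module.finrank ℚ k) h2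
    exact absurd (Nat.lt_of_lt_of_le (Nat.mul_lt_mul_of_pos_right hk h4) h3) (by omega)
  have htd : t ∣ orderOf g := (hmodp _).mp
    ((dvd_pow_self p hn).trans ((hgpow _).mp (pow_orderOf_eq_one g)))
  refine ⟨IntermediateField.fixedField (Subgroup.zpowers (g ^ t)), ?_, ?_⟩
  · have h1 := IntermediateField.finrank_fixedField_eq_card (Subgroup.zpowers (g ^ t))
    have h2 := Module.finrank_mul_finrank k
      (IntermediateField.fixedField (Subgroup.zpowers (g ^ t))) L
    rw [h1, Nat.card_zpowers, orderOf_pow_of_dvd ht0.ne' htd, ← hcard] at h2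
    have h3 : 0 < orderOf g / t := Nat.div_pos (Nat.le_of_dvd (orderOf_pos g) htd) ht0
    refine Nat.eq_of_mul_eq_mul_right h3 ?_
    rw [h2, Nat.mul_div_cancel' htd]
  · have hroot : IsPrimitiveRoot (ζ ^ p ^ (n - m)) (p ^ m) :=
      hζ.pow hpn (by rw [← pow_add, Nat.sub_add_cancel hmn])
    have hfix : (g ^ t) • ζ ^ p ^ (n - m) = ζ ^ p ^ (n - m) := by
      obtain ⟨u, hu⟩ : p ^ m ∣ ℓ ^ t - 1 := pow_padicValNat_dvd
      have h1 : ℓ ^ t = p ^ m * u + 1 := by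
        rw [← hu, Nat.sub_add_cancel (Nat.one_le_pow _ _ hℓ.pos)]
      rw [smul_pow', MulEquiv.pow_apply_of_apply_eq_pow hg, h1, pow_right_comm,
        pow_succ, pow_mul, hroot.pow_eq_one, one_pow, one_mul]
    have hfix' : (g ^ t) (algebraMap (𝓞 L) L (ζ ^ p ^ (n - m))) =
        algebraMap (𝓞 L) L (ζ ^ p ^ (n - m)) := by
      conv_rhs => rw [← hfix]
      rfl
    have hmem : algebraMap (𝓞 L) L (ζ ^ p ^ (n - m)) ∈
        IntermediateField.fixedField (Subgroup.zpowers (g ^ t)) := by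
      rw [IntermediateField.mem_fixedField_iff]
      intro f hf
      have : Subgroup.zpowers (g ^ t) ≤
          MulAction.stabilizer Gal(L/k) (algebraMap (𝓞 L) L (ζ ^ p ^ (n - m))) := by
        rw [Subgroup.zpowers_le]
        exact hfix'
      exact this hf
    refine ⟨⟨_, hmem⟩, ?_⟩
    have := hroot.map_of_injective (f := algebraMap (𝓞 L) L) RingOfIntegers.coe_injective
    exact IsPrimitiveRoot.of_map_of_injective
      (f := (IntermediateField.fixedField (Subgroup.zpowers (g ^ t))).val) this
      Subtype.val_injective

end

section

open NumberField

theorem exists_prime_extension_primitiveRoot (k : Type*) [Field k] [NumberField k] {p : ℕ}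
    (hp : p.Prime) (hp2 : p ≠ 2) (B : ℕ) :
    ∃ ℓ : ℕ, ℓ.Prime ∧ B < ℓ ∧ p < ℓ ∧ Nonempty (𝓞 k →+* ZMod ℓ) ∧
      ∃ (n : ℕ) (_ : n ≠ 0) (E : IntermediateField k (CyclotomicField n k)),
        Module.finrank k E = orderOf (ℓ : ZMod p) ∧
        ∃ ξ : E, IsPrimitiveRoot ξ (p ^ padicValNat p (ℓ ^ orderOf (ℓ : ZMod p) - 1)) := by
  have : Fact p.Prime := ⟨hp⟩
  obtain ⟨n, hn⟩ : ∃ n, Module.finrank ℚ k < p ^ n := ⟨_, Nat.lt_pow_self hp.one_lt⟩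
  have hN : p ^ (n + 1) ≠ 0 := (pow_pos hp.pos _).ne'
  have : NeZero (p ^ (n + 1)) := ⟨hN⟩
  let L := CyclotomicField (p ^ (n + 1)) k
  have : IsGalois k L := IsCyclotomicExtension.isGalois {p ^ (n + 1)} k L
  have hμ : IsPrimitiveRoot (IsCyclotomicExtension.zeta (p ^ (n + 1)) k L) (p ^ (n + 1)) :=
    IsCyclotomicExtension.zeta_spec _ _ _
  have hinj := hμ.autToPow_injective k
  have : IsCyclic (ZMod (p ^ (n + 1)))ˣ := ZMod.isCyclic_units_of_prime_pow p hp hp2 (n + 1)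
  have : IsCyclic Gal(L/k) := isCyclic_of_injective _ hinj
  have hgen : ∀ g : Gal(L/k), g • hμ.toInteger = hμ.toInteger → g = 1 := by
    intro g hg
    apply hinj
    apply Units.ext
    apply ZMod.val_injective
    refine hμ.pow_inj (ZMod.val_lt _) (ZMod.val_lt _) ?_
    rw [IsPrimitiveRoot.autToPow_spec, IsPrimitiveRoot.autToPow_spec]
    exact congrArg (algebraMap (𝓞 L) L) hg
  obtain ⟨ℓ, hℓ, hB, hne, g, hg, htop⟩ := exists_prime_gt_zpowers_eq_top hN
    hμ.toInteger_isPrimitiveRoot hgen (max B p)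
  refine ⟨ℓ, hℓ, (le_max_left _ _).trans_lt hB, (le_max_right _ _).trans_lt hB, hne, _, hN,
    exists_fixedField_primitiveRoot hp hℓ n.succ_ne_zero ((le_max_right _ _).trans_lt hB) hn
      hμ.toInteger_isPrimitiveRoot hgen hg htop⟩

end

section

/-- The wreath product of `C` with the symmetric group on `r` letters. -/
abbrev MonomialGroup (C : Type*) [Group C] (r : ℕ) : Type _ :=
  (Fin r → C) ⋊[mulAutArrow] Equiv.Perm (Fin r)

theorem MonomialGroup.card (C : Type*) [Group C] (r : ℕ) :
    Nat.card (MonomialGroup C r) = Nat.card C ^ r * r.factorial := by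
  rw [SemidirectProduct.card, Nat.card_fun, Nat.card_perm]
  simp

variable {C K E : Type*} [Group C] [Field K] [Field E] [Algebra K E]

/-- The action of the wreath product by monomial transformations, extended by the trivial
action on a complement. -/
def MonomialGroup.toEnd (χ : C →* E) (r s : ℕ) :
    MonomialGroup C r →* Module.End K ((Fin r → E) × (Fin s → K)) where
  toFun w := LinearMap.prodMap (LinearMap.pi fun i ↦
    (LinearMap.mulLeft K (χ (w.left i))).comp (LinearMap.proj (w.right⁻¹ i))) LinearMap.id
  map_one' := by
    refine LinearMap.ext fun v ↦ Prod.ext (funext fun i ↦ ?_) rfl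
    simp
  map_mul' w w' := by
    refine LinearMap.ext fun v ↦ Prod.ext (funext fun i ↦ ?_) rfl
    simp only [mulAutArrow, SemidirectProduct.mul_left, SemidirectProduct.mul_right]
    simp
    exact Or.inl (Or.inl rfl)

theorem MonomialGroup.toEnd_injective {χ : C →* E} (hχ : Function.Injective χ) (r s : ℕ) :
    Function.Injective (MonomialGroup.toEnd (K := K) χ r s) := by
  have hχ0 : ∀ c, χ c ≠ 0 := fun c h ↦ by
    have : χ (c * c⁻¹) = 0 := by rw [map_mul, h, zero_mul]
    rw [mul_inv_cancel, map_one] at this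
    exact one_ne_zero this
  rw [injective_iff_map_eq_one]
  intro w hw
  have h : ∀ (v : Fin r → E) (i : Fin r), χ (w.left i) * v (w.right⁻¹ i) = v i := fun v i ↦
    congrFun (congrArg Prod.fst (DFunLike.congr_fun hw (v, 0))) i
  have h1 : w.left = 1 := funext fun i ↦ hχ (by simpa using h 1 i)
  have h2 : w.right = 1 := by
    rw [← inv_eq_one]
    refine Equiv.ext fun i ↦ ?_
    by_contra hne
    have := h (Pi.single i 1) i
    rw [Pi.single_eq_same, Pi.single_eq_of_ne (show w.right⁻¹ i ≠ i from hne), mul_zero] at this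
    exact zero_ne_one this
  exact SemidirectProduct.ext h1 h2

theorem MonomialGroup.exists_injective_GL [FiniteDimensional K E] {χ : C →* E}
    (hχ : Function.Injective χ) {r d : ℕ} (h : r * Module.finrank K E ≤ d) :
    ∃ f : MonomialGroup C r →* GL (Fin d) K, Function.Injective f := by
  let V := (Fin r → E) × (Fin (d - r * Module.finrank K E) → K)
  have hV : Module.finrank K V = d := by
    rw [Module.finrank_prod, Module.finrank_pi_fintype, Module.finrank_fin_fun]
    simp [h]
  let e := LinearMap.toMatrixAlgEquiv (Module.finBasisOfFinrankEq K V hV)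
  let f : MonomialGroup C r →* Matrix (Fin d) (Fin d) K :=
    (e : Module.End K V →* Matrix (Fin d) (Fin d) K).comp (MonomialGroup.toEnd χ r _)
  refine ⟨f.toHomUnits, fun x y hxy ↦ ?_⟩
  exact MonomialGroup.toEnd_injective hχ r _ (e.injective (congrArg Units.val hxy))

theorem IsPrimitiveRoot.exists_injective_monoidHom {q : ℕ} (hq : q ≠ 0) {ξ : E}
    (hξ : IsPrimitiveRoot ξ q) :
    ∃ χ : Multiplicative (ZMod q) →* E, Function.Injective χ := by
  have hu : IsPrimitiveRoot (hξ.isUnit hq).unit q := by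
    rw [← IsPrimitiveRoot.coe_units_iff]
    exact hξ
  refine ⟨(Units.coeHom E).comp ((Subgroup.subtype _).comp
    (AddMonoidHom.toMultiplicativeLeft hu.zmodEquivZPowers.toAddMonoidHom)), ?_⟩
  refine Units.val_injective.comp (Subtype.val_injective.comp ?_)
  exact hu.zmodEquivZPowers.injective

theorem FiniteField.exists_isPrimitiveRoot [Finite E] {q : ℕ} (hq : q ∣ Nat.card E - 1) :
    ∃ ξ : E, IsPrimitiveRoot ξ q := by
  have := Fintype.ofFinite E
  obtain ⟨u, hu⟩ := IsCyclic.exists_ofOrder_eq_natCard (α := Eˣ)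
  rw [Nat.card_units] at hu
  obtain ⟨j, hj⟩ := hq
  have hpr : IsPrimitiveRoot (u : E) (Nat.card E - 1) := by
    rw [IsPrimitiveRoot.coe_units_iff, ← hu]
    exact IsPrimitiveRoot.orderOf u
  exact ⟨_, hpr.pow (Nat.sub_pos_of_lt Finite.one_lt_card) (by rw [hj, mul_comm])⟩

end

section

variable {p ℓ : ℕ}

theorem padicValNat_pow_sub_one (hp : p.Prime) (hp2 : p ≠ 2) (hℓ : ℓ.Prime) (hpℓ : p < ℓ) {j : ℕ}
    (hj : j ≠ 0) : padicValNat p (ℓ ^ j - 1) = if orderOf (ℓ : ZMod p) ∣ j then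
      padicValNat p (ℓ ^ orderOf (ℓ : ZMod p) - 1) + padicValNat p (j / orderOf (ℓ : ZMod p))
      else 0 := by
  have : Fact p.Prime := ⟨hp⟩
  have hmodp : ∀ j, p ∣ ℓ ^ j - 1 ↔ orderOf (ℓ : ZMod p) ∣ j := fun j ↦ by
    rw [orderOf_dvd_iff_pow_eq_one, ← ZMod.natCast_eq_zero_iff,
      Nat.cast_sub (Nat.one_le_pow _ _ hℓ.pos), sub_eq_zero]
    simp
  split_ifs with h
  · obtain ⟨a, rfl⟩ := h
    have ht := left_ne_zero_of_mul hj
    rw [Nat.mul_div_cancel_left _ (Nat.pos_of_ne_zero ht), pow_mul]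
    conv_lhs => rw [← one_pow a]
    refine padicValNat.pow_sub_pow (hp.odd_of_ne_two hp2) (Nat.one_lt_pow ht hℓ.one_lt)
      ((hmodp _).mpr dvd_rfl) ?_ (right_ne_zero_of_mul hj)
    intro h
    exact hpℓ.ne ((Nat.prime_dvd_prime_iff_eq hp hℓ).mp (hp.dvd_of_dvd_pow h))
  · exact padicValNat.eq_zero_of_not_dvd (by rwa [hmodp])

theorem sum_padicValNat_pow_sub_one (hp : p.Prime) (hp2 : p ≠ 2) (hℓ : ℓ.Prime) (hpℓ : p < ℓ)
    (d : ℕ) : ∑ j ∈ Finset.range d, padicValNat p (ℓ ^ (j + 1) - 1) =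
      padicValNat p (ℓ ^ orderOf (ℓ : ZMod p) - 1) * (d / orderOf (ℓ : ZMod p)) +
        padicValNat p (d / orderOf (ℓ : ZMod p)).factorial := by
  have : Fact p.Prime := ⟨hp⟩
  induction d with
  | zero => simp
  | succ d ih =>
    rw [Finset.sum_range_succ, ih, padicValNat_pow_sub_one hp hp2 hℓ hpℓ d.succ_ne_zero,
      Nat.succ_div]
    split_ifs with h
    · rw [Nat.factorial_succ, padicValNat.mul (Nat.succ_ne_zero _) (Nat.factorial_ne_zero _)]
      ring
    · simp

theorem padicValNat_card_GL (hp : p.Prime) (hp2 : p ≠ 2) (hℓ : ℓ.Prime) (hpℓ : p < ℓ) (d : ℕ)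
    {q r : ℕ} (hq : q = p ^ padicValNat p (ℓ ^ orderOf (ℓ : ZMod p) - 1))
    (hr : r = d / orderOf (ℓ : ZMod p)) :
    padicValNat p (Nat.card (GL (Fin d) (ZMod ℓ))) =
      padicValNat p (Nat.card (MonomialGroup (Multiplicative (ZMod q)) r)) := by
  have : Fact p.Prime := ⟨hp⟩
  have : Fact ℓ.Prime := ⟨hℓ⟩
  have hq0 : q ≠ 0 := hq ▸ (pow_pos hp.pos _).ne'
  have hcard : Nat.card (Multiplicative (ZMod q)) = q := Nat.card_zmod q
  have hpl : ¬ p ∣ ℓ := fun h ↦ hpℓ.ne ((Nat.prime_dvd_prime_iff_eq hp hℓ).mp h)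
  rw [MonomialGroup.card, hcard, padicValNat.mul (pow_ne_zero _ hq0) (Nat.factorial_ne_zero _),
    padicValNat.pow, hq, padicValNat.prime_pow, hr, mul_comm (d / _),
    ← sum_padicValNat_pow_sub_one hp hp2 hℓ hpℓ, Matrix.card_GL_field, ZMod.card]
  have hfac : ∀ i : Fin d, ℓ ^ d - ℓ ^ (i : ℕ) = ℓ ^ (i : ℕ) * (ℓ ^ (d - i) - 1) := fun i ↦ by
    rw [Nat.mul_sub, ← pow_add, Nat.add_sub_cancel' i.2.le, mul_one]
  have hne : ∀ i : Fin d, ℓ ^ (d - (i : ℕ)) - 1 ≠ 0 := fun i ↦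
    (Nat.sub_pos_of_lt (Nat.one_lt_pow (by omega) hℓ.one_lt)).ne'
  have hval : ∀ i : Fin d, padicValNat p (ℓ ^ d - ℓ ^ (i : ℕ)) =
      padicValNat p (ℓ ^ (d - i) - 1) := fun i ↦ by
    rw [hfac, padicValNat.mul (pow_pos hℓ.pos _).ne' (hne i), padicValNat.eq_zero_of_not_dvd
      (fun h ↦ hpl (hp.dvd_of_dvd_pow h)), zero_add]
  have hprod : ∀ s : Finset (Fin d), padicValNat p (∏ i ∈ s, (ℓ ^ d - ℓ ^ (i : ℕ))) =
      ∑ i ∈ s, padicValNat p (ℓ ^ (d - i) - 1) := by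
    intro s
    induction s using Finset.induction_on with
    | empty => simp
    | insert a s ha ih =>
      rw [Finset.prod_insert ha, Finset.sum_insert ha, padicValNat.mul, ih, hval]
      · rw [hfac]
        exact mul_ne_zero (pow_pos hℓ.pos _).ne' (hne a)
      · refine Finset.prod_ne_zero_iff.mpr fun i _ ↦ ?_
        rw [hfac]
        exact mul_ne_zero (pow_pos hℓ.pos _).ne' (hne i)
  rw [hprod, ← Fin.sum_univ_eq_sum_range (fun j ↦ padicValNat p (ℓ ^ (j + 1) - 1)),
    ← Equiv.sum_comp Fin.revPerm]
  refine Finset.sum_congr rfl fun i _ ↦ ?_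
  congr 3
  simp only [Fin.revPerm_apply, Fin.val_rev]
  omega

theorem exists_monoidHom_injective_of_card {G₁ G₂ W : Type*} [Group G₁] [Finite G₁] [Group G₂]
    [Finite G₂] [Group W] [Finite W] [Fact p.Prime] {f : W →* G₂} (hf : Function.Injective f)
    (hcard : padicValNat p (Nat.card G₂) = padicValNat p (Nat.card W)) (hG : IsPGroup p G₁)
    {g : G₁ →* G₂} (hg : Function.Injective g) : ∃ h : G₁ →* W, Function.Injective h := by
  obtain ⟨P⟩ : Nonempty (Sylow p W) := inferInstance
  have hP : Nat.card ((P : Subgroup W).map f) = p ^ (Nat.card G₂).factorization p := by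
    rw [← Nat.card_congr ((P : Subgroup W).equivMapOfInjective f hf).toEquiv,
      P.card_eq_multiplicity, Nat.factorization_def _ Fact.out, Nat.factorization_def _ Fact.out,
      hcard]
  let Q : Sylow p G₂ := Sylow.ofCard _ hP
  obtain ⟨R, hR⟩ := (hG.of_equiv (MonoidHom.ofInjective hg)).exists_le_sylow
  obtain ⟨c, hc⟩ := MulAction.exists_smul_eq G₂ R Q
  have hmem : ∀ x, MulAut.conj c (g x) ∈ f.range := fun x ↦ by
    have h1 : MulAut.conj c (g x) ∈ (Q : Subgroup G₂) := by
      rw [← hc]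
      exact Subgroup.smul_mem_pointwise_smul _ _ _ (hR ⟨x, rfl⟩)
    obtain ⟨w, -, hw⟩ := h1
    exact ⟨w, hw⟩
  let g' : G₁ →* f.range := ((MulAut.conj c).toMonoidHom.comp g).codRestrict _ hmem
  refine ⟨(MonoidHom.ofInjective hf).symm.toMonoidHom.comp g', ?_⟩
  refine (MonoidHom.ofInjective hf).symm.injective.comp fun x y hxy ↦ hg ?_
  exact (MulAut.conj c).injective (congrArg Subtype.val hxy)

end

namespace MvPolynomial

variable {σ F : Type*} [Field F]

theorem pderiv_algHom_apply [Fintype σ] (φ : MvPolynomial σ F →ₐ[F] MvPolynomial σ F) (j : σ)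
    (f : MvPolynomial σ F) :
    pderiv j (φ f) = ∑ k, φ (pderiv k f) * pderiv j (φ (X k)) := by
  classical
  induction f using MvPolynomial.induction_on with
  | C a => simp [← algebraMap_eq]
  | add f g hf hg => simp [hf, hg, add_mul, Finset.sum_add_distrib]
  | mul_X f i hf =>
    simp only [map_mul, Derivation.leibniz, smul_eq_mul, map_add, hf, pderiv_X, add_mul,
      Finset.sum_add_distrib, Finset.mul_sum]
    congr 1
    · rw [Finset.sum_eq_single i]
      · simp
      · intro b _ hb
        simp [hb.symm]
      · simp
    · simp [mul_assoc]

theorem sub_sub_sum_mem_ker_sq [Fintype σ] (ψ : MvPolynomial σ F →ₐ[F] F) (f : MvPolynomial σ F) :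
    f - C (ψ f) - ∑ i, C (ψ (pderiv i f)) * (X i - C (ψ (X i))) ∈ RingHom.ker ψ ^ 2 := by
  classical
  have hC (a : F) : ψ (C a) = a := ψ.commutes a
  induction f using MvPolynomial.induction_on with
  | C a => simp [hC]
  | add f g hf hg =>
    convert add_mem hf hg using 1
    simp only [map_add, add_mul, Finset.sum_add_distrib]
    ring
  | mul_X f i hf =>
    have h1 : (f - C (ψ f)) * (X i - C (ψ (X i))) ∈ RingHom.ker ψ ^ 2 := by
      rw [pow_two]
      refine Ideal.mul_mem_mul ?_ ?_ <;> simp [RingHom.mem_ker, hC]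
    have h2 := Ideal.mul_mem_left _ (C (ψ (X i))) hf
    convert add_mem h1 h2 using 1
    have h3 : ∑ j, C (ψ (pderiv j (f * X i))) * (X j - C (ψ (X j))) =
        C (ψ f) * (X i - C (ψ (X i))) +
          C (ψ (X i)) * ∑ j, C (ψ (pderiv j f)) * (X j - C (ψ (X j))) := by
      simp only [Derivation.leibniz, smul_eq_mul, map_add, map_mul, add_mul,
        Finset.sum_add_distrib, Finset.mul_sum, mul_assoc]
      congr 1
      rw [Finset.sum_eq_single i]
      · simp
      · intro b _ hb
        simp [pderiv_X, hb.symm]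
      · simp
    rw [h3, map_mul, C_mul]
    ring

theorem sub_mem_ker_sq [Fintype σ] {ψ : MvPolynomial σ F →ₐ[F] F}
    {φ : MvPolynomial σ F →ₐ[F] MvPolynomial σ F} (hψ : ∀ f, ψ (φ f) = ψ f)
    (hφ : ∀ i j, ψ (pderiv j (φ (X i))) = ψ (pderiv j (X i))) (f : MvPolynomial σ F) :
    φ f - f ∈ RingHom.ker ψ ^ 2 := by
  have h (j) : ψ (pderiv j (φ f)) = ψ (pderiv j f) := by
    classical
    rw [pderiv_algHom_apply, map_sum, Finset.sum_eq_single j]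
    · simp [hψ, hφ]
    · intro b _ hb
      simp [hφ, pderiv_X, hb]
    · simp
  have := sub_mem (sub_sub_sum_mem_ker_sq ψ (φ f)) (sub_sub_sum_mem_ker_sq ψ f)
  simpa [h, hψ] using this

theorem sub_mem_ker_pow_succ [Fintype σ] {ψ : MvPolynomial σ F →ₐ[F] F}
    {φ : MvPolynomial σ F →ₐ[F] MvPolynomial σ F} (hψ : ∀ f, ψ (φ f) = ψ f)
    (hφ : ∀ i j, ψ (pderiv j (φ (X i))) = ψ (pderiv j (X i))) (n : ℕ) :
    ∀ f ∈ RingHom.ker ψ ^ n, φ f - f ∈ RingHom.ker ψ ^ (n + 1) := by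
  induction n with
  | zero => 
    intro f _
    exact Ideal.pow_le_pow_right (by norm_num) (sub_mem_ker_sq hψ hφ f)
  | succ n ih =>
    intro f hf
    rw [pow_succ] at hf
    refine Submodule.mul_induction_on hf ?_ ?_
    · intro a ha b hb
      have h1 : (φ a - a) * φ b ∈ RingHom.ker ψ ^ (n + 1 + 1) := by
        rw [pow_succ]
        refine Ideal.mul_mem_mul (ih a ha) ?_
        rw [RingHom.mem_ker] at hb ⊢
        exact (hψ b).trans hb
      have h2 : a * (φ b - b) ∈ RingHom.ker ψ ^ (n + 1 + 1) := by
        rw [show n + 1 + 1 = n + 2 from rfl, pow_add]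
        exact Ideal.mul_mem_mul ha (sub_mem_ker_sq hψ hφ b)
      convert add_mem h1 h2 using 1
      rw [map_mul]
      ring
    · intro a b ha hb
      convert add_mem ha hb using 1
      rw [map_add]
      ring

theorem algHom_eq_id_of_tangent [Fintype σ] {ψ : MvPolynomial σ F →ₐ[F] F}
    {φ : MvPolynomial σ F →ₐ[F] MvPolynomial σ F} (hψ : ∀ f, ψ (φ f) = ψ f)
    (hφ : ∀ i j, ψ (pderiv j (φ (X i))) = ψ (pderiv j (X i))) {m : ℕ} (hm : (m : F) ≠ 0)
    (hpow : φ ^ m = 1) : φ = 1 := by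
  ext1 i
  rw [AlgHom.one_apply, ← sub_eq_zero]
  set u := φ (X i) - X i with hu
  have hiter (n : ℕ) {j : ℕ} {v} (hv : v ∈ RingHom.ker ψ ^ j) :
      (φ ^ n) v - v ∈ RingHom.ker ψ ^ (j + 1) := by
    induction n with
    | zero => simp
    | succ n ih =>
      have hv' : (φ ^ n) v ∈ RingHom.ker ψ ^ j := by
        simpa using add_mem (Ideal.pow_le_pow_right (Nat.le_succ j) ih) hv
      convert add_mem (sub_mem_ker_pow_succ hψ hφ j _ hv') ih using 1
      rw [pow_succ', AlgHom.mul_apply]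
      ring
  have hsum (n : ℕ) : ∑ l ∈ Finset.range n, (φ ^ l) u = (φ ^ n) (X i) - X i := by
    induction n with
    | zero => simp
    | succ n ih => 
      rw [Finset.sum_range_succ, ih, hu, map_sub, pow_succ, AlgHom.mul_apply]
      ring
  have hmem (j : ℕ) : u ∈ RingHom.ker ψ ^ j := by
    induction j with
    | zero => simp
    | succ j ih =>
      have h0 := hsum m
      rw [hpow, AlgHom.one_apply, sub_self] at h0
      have h1 : ∑ l ∈ Finset.range m, ((φ ^ l) u - u) ∈ RingHom.ker ψ ^ (j + 1) :=
        sum_mem fun l _ ↦ hiter l ih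
      rw [Finset.sum_sub_distrib, h0, Finset.sum_const, Finset.card_range, zero_sub, neg_mem_iff,
        ] at h1
      have h2 := Ideal.mul_mem_left _ (C ((m : F)⁻¹)) h1
      rwa [nsmul_eq_mul, ← mul_assoc, ← map_natCast (C : F →+* MvPolynomial σ F), ← C_mul,
        inv_mul_cancel₀ hm, C_1, one_mul] at h2
  have := Ideal.iInf_pow_eq_bot_of_isDomain (RingHom.ker ψ) (RingHom.ker_ne_top ψ)
  have h3 : u ∈ (⨅ j, RingHom.ker ψ ^ j : Ideal (MvPolynomial σ F)) := by
    simpa [Ideal.mem_iInf] using hmem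
  simpa [this] using h3

theorem exists_fixed_point [Fintype σ] [Finite F] {p : ℕ} [Fact p.Prime] (hp : (p : F) ≠ 0)
    {G : Type*} [Group G] [Finite G] (hG : IsPGroup p G)
    (τ : G →* (MvPolynomial σ F →ₐ[F] MvPolynomial σ F)) :
    ∃ ψ : MvPolynomial σ F →ₐ[F] F, ∀ g f, ψ (τ g f) = ψ f := by
  let _ : MulAction G (MvPolynomial σ F →ₐ[F] F) :=
    { smul g ψ := ψ.comp (τ g⁻¹)
      one_smul ψ := by
        change ψ.comp (τ 1⁻¹) = ψ
        ext; simp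
      mul_smul g h ψ := by
        change ψ.comp (τ (g * h)⁻¹) = (ψ.comp (τ h⁻¹)).comp (τ g⁻¹)
        ext; simp }
  let e : (MvPolynomial σ F →ₐ[F] F) ≃ (σ → F) :=
    { toFun ψ i := ψ (X i)
      invFun x := aeval x
      left_inv ψ := by ext; simp
      right_inv x := by ext; simp }
  have : Finite (MvPolynomial σ F →ₐ[F] F) := Finite.of_equiv _ e.symm
  have hcard : ¬ p ∣ Nat.card (MvPolynomial σ F →ₐ[F] F) := by
    rw [Nat.card_congr e, Nat.card_fun]
    intro h
    have h1 := (Fact.out : p.Prime).dvd_of_dvd_pow h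
    have := Fintype.ofFinite F
    obtain ⟨c, hc⟩ := CharP.exists F
    obtain ⟨n, hc', hn⟩ := FiniteField.card F c
    rw [Nat.card_eq_fintype_card, hn] at h1
    have h2 := (Nat.prime_dvd_prime_iff_eq Fact.out hc').mp
      ((Fact.out : p.Prime).dvd_of_dvd_pow h1)
    exact hp (by rw [h2, CharP.cast_eq_zero])
  obtain ⟨ψ, hψ⟩ := hG.nonempty_fixed_point_of_prime_not_dvd_card _ hcard
  refine ⟨ψ, fun g f ↦ ?_⟩
  have := hψ g⁻¹
  change ψ.comp (τ g⁻¹⁻¹) = ψ at this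
  rw [inv_inv] at this
  exact DFunLike.congr_fun this f

theorem exists_injective_GL [Finite F] {p d : ℕ} [Fact p.Prime] (hp : (p : F) ≠ 0)
    {G : Type*} [Group G] [Finite G] (hG : IsPGroup p G)
    {τ : G →* (MvPolynomial (Fin d) F →ₐ[F] MvPolynomial (Fin d) F)}
    (hτ : Function.Injective τ) :
    ∃ f : G →* GL (Fin d) F, Function.Injective f := by
  obtain ⟨ψ, hψ⟩ := exists_fixed_point hp hG τ
  let J : G →* Matrix (Fin d) (Fin d) F :=
    { toFun g := .of fun j i ↦ ψ (pderiv j (τ g (X i)))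
      map_one' := by
        ext i j
        simp [pderiv_X, Matrix.one_apply, Pi.single_apply, eq_comm, apply_ite ψ]
      map_mul' g h := by
        ext j i
        simp only [Matrix.of_apply, map_mul, AlgHom.mul_apply, Matrix.mul_apply]
        rw [pderiv_algHom_apply]
        simp [hψ, mul_comm] }
  have hJ : Function.Injective J := by
    rw [injective_iff_map_eq_one]
    intro g hg
    apply hτ
    rw [map_one]
    refine algHom_eq_id_of_tangent (hψ g) (m := Nat.card G) (fun i j ↦ ?_) ?_ ?_
    · have h1 := congrFun₂ (hg.trans (map_one J).symm) j i
      simpa [J] using h1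
    · obtain ⟨n, hn⟩ := IsPGroup.iff_card.mp hG
      rw [hn, Nat.cast_pow]
      exact pow_ne_zero _ hp
    · rw [← map_pow, pow_card_eq_one', map_one]
  refine ⟨J.toHomUnits, fun g h hgh ↦ hJ ?_⟩
  simpa using congrArg Units.val hgh

end MvPolynomial

section

open NumberField

theorem NumberField.exists_bound_forall_exists_subring {k : Type*} [Field k] [NumberField k]
    (S : Finset k) : ∃ B : ℕ, ∀ ℓ : ℕ, ℓ.Prime → B < ℓ → ∀ _ : 𝓞 k →+* ZMod ℓ,
      ∃ R : Subring k, (S : Set k) ⊆ R ∧ Nonempty (R →+* ZMod ℓ) := by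
  obtain ⟨b, hb⟩ := IsLocalization.exist_integer_multiples_of_finset (nonZeroDivisors (𝓞 k)) S
  refine ⟨Ideal.absNorm (Ideal.span {(b : 𝓞 k)}), fun ℓ hℓ hB φ ↦ ?_⟩
  have : Fact ℓ.Prime := ⟨hℓ⟩
  have hb0 : (b : 𝓞 k) ≠ 0 := nonZeroDivisors.coe_ne_zero b
  have hφb : φ b ≠ 0 := fun h ↦ by
    obtain ⟨c, hc⟩ := Ideal.mem_span_singleton.mp
      (Ideal.absNorm_mem (Ideal.span {(b : 𝓞 k)}))
    have h1 : ((Ideal.absNorm (Ideal.span {(b : 𝓞 k)}) : ℕ) : ZMod ℓ) = 0 := by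
      rw [← map_natCast φ, hc, map_mul, h, zero_mul]
    rw [ZMod.natCast_eq_zero_iff] at h1
    refine (Nat.le_of_dvd (Nat.pos_of_ne_zero ?_) h1).not_gt hB
    rw [Ne, Ideal.absNorm_eq_zero_iff, Ideal.span_singleton_eq_bot]
    exact hb0
  have : (RingHom.ker φ).IsPrime := RingHom.ker_isPrime φ
  have hM : (RingHom.ker φ).primeCompl ≤ nonZeroDivisors (𝓞 k) :=
    Ideal.primeCompl_le_nonZeroDivisors _
  let R := Localization.subalgebra.ofField k _ hM
  refine ⟨R.toSubring, fun s hs ↦ ?_, ⟨?_⟩⟩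
  · obtain ⟨a, ha⟩ := hb s hs
    change s ∈ R
    refine ⟨a, b, hφb, ?_⟩
    rw [ha, Algebra.smul_def, mul_comm, ← mul_assoc, inv_mul_cancel₀, one_mul]
    rwa [Ne, FaithfulSMul.algebraMap_eq_zero_iff]
  · exact IsLocalization.lift (M := (RingHom.ker φ).primeCompl) (S := R) (g := φ) fun y ↦
      isUnit_iff_ne_zero.mpr y.2

end

theorem MvPolynomial.exists_monoidHom_specialization {σ K F : Type*} [Field K] [Field F]
    {G : Type*} [Group G] {α : G →* (MvPolynomial σ K ≃ₐ[K] MvPolynomial σ K)} {R : Subring K}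
    (φ : R →+* F) (hα : ∀ g i n, coeff n (α g (X i)) ∈ R)
    (hinj : ∀ g ≠ 1, ∃ i n, coeff n (α g (X i) - X i) ≠ 0 ∧ (coeff n (α g (X i) - X i))⁻¹ ∈ R) :
    ∃ τ : G →* (MvPolynomial σ F →ₐ[F] MvPolynomial σ F), Function.Injective τ := by
  have hP : ∀ g i, ∃ P : MvPolynomial σ R, map R.subtype P = α g (X i) := fun g i ↦ by
    rw [← Set.mem_range, mem_range_map_iff_coeffs_subset]
    intro c hc
    obtain ⟨n, -, rfl⟩ := mem_coeffs_iff.mp hc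
    simpa using hα g i n
  choose P hP using hP
  have hmap : Function.Injective (map R.subtype : MvPolynomial σ R →+* MvPolynomial σ K) :=
    map_injective _ Subtype.val_injective
  have hmapα (g) (f : MvPolynomial σ R) :
      map R.subtype (aeval (P g) f) = α g (map R.subtype f) := by
    induction f using MvPolynomial.induction_on with
    | C a =>
      rw [aeval_C, algebraMap_eq, map_C]
      exact ((α g).commutes _).symm
    | add f g hf hg => simp only [map_add, hf, hg]
    | mul_X f i hf => simp only [map_mul, hf, aeval_X, hP, map_X]
  have hmapφ (g) (f : MvPolynomial σ R) :
      map φ (aeval (P g) f) = aeval (fun i ↦ map φ (P g i)) (map φ f) := by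
    induction f using MvPolynomial.induction_on with
    | C a => simp [← algebraMap_eq]
    | add f g hf hg => simp only [map_add, hf, hg]
    | mul_X f i hf => simp only [map_mul, hf, aeval_X, map_X]
  let τ : G →* (MvPolynomial σ F →ₐ[F] MvPolynomial σ F) :=
    { toFun g := aeval fun i ↦ map φ (P g i)
      map_one' := by
        ext1 i
        have : P 1 i = X i := hmap (by simp [hP])
        simp [this]
      map_mul' g h := by
        ext1 i
        have : P (g * h) i = aeval (P g) (P h i) := hmap (by rw [hmapα, hP, hP, map_mul, AlgEquiv.mul_apply])
        rw [AlgHom.mul_apply, aeval_X, aeval_X, this, hmapφ] }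
  refine ⟨τ, (injective_iff_map_eq_one τ).mpr fun g hg ↦ ?_⟩
  by_contra hne
  obtain ⟨i, n, h0, hR⟩ := hinj g hne
  have h1 : map φ (P g i - X i) = 0 := by
    have := DFunLike.congr_fun hg (X i)
    simpa [τ, sub_eq_zero] using this
  have h2 : R.subtype (coeff n (P g i - X i)) = coeff n (α g (X i) - X i) := by
    rw [← coeff_map, map_sub, hP, map_X]
  have h3 : coeff n (P g i - X i) * ⟨_, hR⟩ = 1 := by
    refine Subtype.ext ?_
    change R.subtype (coeff n (P g i - X i)) * _ = 1
    rw [h2, mul_inv_cancel₀ h0]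
  have h4 := congrArg φ h3
  rw [map_mul, ← coeff_map, h1, coeff_zero, zero_mul, map_one] at h4
  exact zero_ne_one h4

/-- Let `k` be a number field, `d` a natural number, and `p ≥ 3` a prime. If `G` is a finite
`p`-subgroup of the group of polynomial automorphisms of affine `d`-space over `k` (i.e. of
`k`-algebra automorphisms of `k[x_1,…,x_d]`), then `G` embeds into `GL_d(k)`. -/
theorem schur_bound_polynomial (k : Type*) [Field k] [CharZero k] [FiniteDimensional ℚ k]
    (d p : ℕ) (hp : p.Prime) (hp3 : 3 ≤ p)
    (G : Subgroup (MvPolynomial (Fin d) k ≃ₐ[k] MvPolynomial (Fin d) k))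
    (hG : Finite G) (hcard : ∃ α : ℕ, Nat.card G = p ^ α) :
    ∃ f : G →* GL (Fin d) k, Function.Injective f := by
  classical
  have : NumberField k := { }
  have : Fact p.Prime := ⟨hp⟩
  have hp2 : p ≠ 2 := by omega
  have hpG : IsPGroup p G := by
    obtain ⟨a, ha⟩ := hcard
    exact IsPGroup.of_card ha
  have hne : ∀ g : G, ∃ c : k, g ≠ 1 → ∃ (i : Fin d) (n : Fin d →₀ ℕ), c ≠ 0 ∧
      MvPolynomial.coeff n (G.subtype g (MvPolynomial.X i) - MvPolynomial.X i) = c := fun g ↦ by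
    by_contra! h
    refine (h 0).1 (Subtype.ext (AlgEquiv.coe_toAlgHom_injective ?_))
    ext1 i
    refine MvPolynomial.ext _ _ fun n ↦ ?_
    by_contra hin
    refine (h _).2 i n ?_ rfl
    rwa [MvPolynomial.coeff_sub, sub_ne_zero]
  choose c hc using hne
  have := Fintype.ofFinite G
  let S : Finset k :=
    (Finset.univ.biUnion fun g : G ↦ Finset.univ.biUnion fun j ↦
      (G.subtype g (MvPolynomial.X j)).coeffs) ∪
    Finset.univ.image fun g : G ↦ (c g)⁻¹
  obtain ⟨B, hB⟩ := NumberField.exists_bound_forall_exists_subring S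
  obtain ⟨ℓ, hℓ, hBℓ, hpℓ, ⟨φ⟩, m, hm, E, hE, ξ, hξ⟩ :=
    exists_prime_extension_primitiveRoot k hp hp2 B
  have : Fact ℓ.Prime := ⟨hℓ⟩
  obtain ⟨R, hSR, ⟨φR⟩⟩ := hB ℓ hℓ hBℓ φ
  obtain ⟨τ, hτ⟩ := MvPolynomial.exists_monoidHom_specialization (α := G.subtype) φR
    (fun g j n ↦ by
      by_cases h : MvPolynomial.coeff n (G.subtype g (MvPolynomial.X j)) = 0
      · rw [h]
        exact R.zero_mem
      · refine hSR (Finset.mem_coe.mpr (Finset.mem_union_left _ ?_))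
        simp only [Finset.mem_biUnion]
        exact ⟨g, Finset.mem_univ _, j, Finset.mem_univ _,
          MvPolynomial.coeff_mem_coeffs n h⟩)
    (fun g hg ↦ by
      obtain ⟨i, n, h0, hcg⟩ := hc g hg
      refine ⟨i, n, hcg ▸ h0, hcg ▸ hSR (Finset.mem_coe.mpr (Finset.mem_union_right _ ?_))⟩
      exact Finset.mem_image_of_mem _ (Finset.mem_univ g))
  have hpF : (p : ZMod ℓ) ≠ 0 := by
    rw [Ne, ZMod.natCast_eq_zero_iff]
    exact fun h ↦ (Nat.le_of_dvd hp.pos h).not_gt hpℓ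
  obtain ⟨g, hg⟩ := MvPolynomial.exists_injective_GL hpF hpG hτ
  set t := orderOf (ℓ : ZMod p) with ht
  set q := p ^ padicValNat p (ℓ ^ t - 1) with hq
  have hq0 : q ≠ 0 := (pow_pos hp.pos _).ne'
  have : NeZero q := ⟨hq0⟩
  have : NeZero m := ⟨hm⟩
  have : FiniteDimensional k (CyclotomicField m k) := IsCyclotomicExtension.finiteDimensional {m} k _
  have ht0 : t ≠ 0 := hE ▸ Module.finrank_pos.ne'
  have hrt : d / t * t ≤ d := Nat.div_mul_le_self d t
  have hfin := GaloisField.finrank ℓ ht0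
  obtain ⟨ξ', hξ'⟩ := FiniteField.exists_isPrimitiveRoot (E := GaloisField ℓ t) (q := q)
    (by rw [GaloisField.card ℓ t ht0]; exact pow_padicValNat_dvd)
  obtain ⟨χ', hχ'⟩ := hξ'.exists_injective_monoidHom hq0
  obtain ⟨f', hf'⟩ := MonomialGroup.exists_injective_GL (K := ZMod ℓ) hχ' (r := d / t) (d := d)
    (by rwa [hfin])
  obtain ⟨χ, hχ⟩ := hξ.exists_injective_monoidHom hq0
  obtain ⟨f, hf⟩ := MonomialGroup.exists_injective_GL (K := k) hχ (r := d / t) (d := d)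
    (by rwa [hE])
  have : Finite (Multiplicative (ZMod q)) := inferInstanceAs (Finite (ZMod q))
  have : Finite (MonomialGroup (Multiplicative (ZMod q)) (d / t)) :=
    Finite.of_equiv _ SemidirectProduct.equivProd.symm
  obtain ⟨h, hh⟩ := exists_monoidHom_injective_of_card hf'
    (padicValNat_card_GL hp hp2 hℓ hpℓ d hq rfl) hpG hg
  exact ⟨f.comp h, hf.comp hh⟩
end

section
/- Let d be a natural number and let G be a finite 2-subgroup of Aut(A^d_ℚ). Then there exists an injective group homomorphism G → GL_d(ℚ(i)), where ℚ(i) is the fourth cyclotomic field, and consequently v_2(|G|) ≤ M_ℚ(d,2) + ⌊d/2⌋, where M_ℚ(d,2) = d + ∑_{k≥1} ⌊d/2^k⌋. -/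
open MvPolynomial in
/-- Chain rule for algebra endomorphisms of a polynomial ring. -/
theorem MvPolynomial.pderiv_algHom {K σ : Type*} [CommRing K] [Fintype σ]
    (s : MvPolynomial σ K →ₐ[K] MvPolynomial σ K) (j : σ) (f : MvPolynomial σ K) :
    pderiv j (s f) = ∑ k, s (pderiv k f) * pderiv j (s (X k)) := by
  classical
  induction f using MvPolynomial.induction_on with
  | C a => simp [← MvPolynomial.algebraMap_eq]
  | add p q hp hq => simp [hp, hq, add_mul, Finset.sum_add_distrib]
  | mul_X p i hp =>
    simp only [map_mul, Derivation.leibniz, smul_eq_mul, hp, pderiv_X, map_add, add_mul,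
      Finset.sum_add_distrib, Pi.single_apply, Finset.mul_sum, apply_ite s, map_zero,
      mul_ite, mul_one, mul_zero, ite_mul, zero_mul, Finset.sum_ite_eq,
      Finset.mem_univ, if_true]
    congr 1
    exact Finset.sum_congr rfl fun k _ => by ring

open MvPolynomial in
/-- First-order Taylor expansion at a point. -/
theorem MvPolynomial.taylor_mem_sq {K σ : Type*} [CommRing K] [Fintype σ] (a : σ → K)
    (f : MvPolynomial σ K) :
    f - C (eval a f) - ∑ i, C (eval a (pderiv i f)) * (X i - C (a i)) ∈
      RingHom.ker (eval a) ^ 2 := by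
  classical
  have hX : ∀ i, X i - C (a i) ∈ RingHom.ker (eval a) := fun i => by
    simp [RingHom.mem_ker]
  induction f using MvPolynomial.induction_on with
  | C c => simp
  | add p q hp hq =>
    convert! add_mem hp hq using 1
    simp only [map_add, add_mul, Finset.sum_add_distrib]
    ring
  | mul_X p i hp =>
    have hL : (∑ k, C (eval a (pderiv k p)) * (X k - C (a k))) * (X i - C (a i)) ∈
        RingHom.ker (eval a) ^ 2 := by
      rw [pow_two]
      exact Ideal.mul_mem_mul (sum_mem fun k _ => Ideal.mul_mem_left _ _ (hX k)) (hX i)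
    convert! add_mem (Ideal.mul_mem_right (X i) _ hp) hL using 1
    have h : ∑ k, C (eval a (pderiv k (p * X i))) * (X k - C (a k)) =
        C (eval a p) * (X i - C (a i)) +
          C (a i) * ∑ k, C (eval a (pderiv k p)) * (X k - C (a k)) := by
      simp only [Derivation.leibniz, smul_eq_mul, pderiv_X, map_add, map_mul, add_mul,
        Finset.sum_add_distrib, Pi.single_apply, eval_X, Finset.mul_sum,
        apply_ite (eval a), apply_ite C, map_zero,
        mul_ite, mul_one, mul_zero, ite_mul, zero_mul, Finset.sum_ite_eq,
        Finset.mem_univ, if_true, mul_assoc]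
    rw [h]
    simp only [map_mul, eval_X]
    ring

open MvPolynomial in
/-- An involution of a polynomial ring that fixes a point and has trivial Jacobian matrix there is
the identity, in characteristic different from two. -/
theorem MvPolynomial.algHom_eq_id_of_jacobian_eq_one {K σ : Type*} [Field K] [Fintype σ]
    [DecidableEq σ] (h2 : (2 : K) ≠ 0)
    (s : MvPolynomial σ K →ₐ[K] MvPolynomial σ K) (hs : ∀ f, s (s f) = f) (a : σ → K)
    (ha : ∀ f, eval a (s f) = eval a f)
    (hJ : ∀ i j, eval a (pderiv j (s (X i))) = if i = j then 1 else 0) (f : MvPolynomial σ K) :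
    s f = f := by
  set m : Ideal (MvPolynomial σ K) := RingHom.ker (eval a) with hm
  have hX : ∀ i, s (X i) - X i ∈ m ^ 2 := fun i => by
    have h := taylor_mem_sq a (s (X i))
    simpa [hJ, ha, apply_ite C] using h
  have hsm : ∀ u ∈ m, s u ∈ m := fun u hu => by
    rw [hm, RingHom.mem_ker] at *
    rw [ha, hu]
  have hs2 : ∀ u ∈ m ^ 2, s u - u ∈ m ^ 2 := fun u hu => by
    refine sub_mem ?_ hu
    rw [pow_two] at hu ⊢
    induction hu using Submodule.mul_induction_on' with
    | mem_mul_mem u hu v hv => rw [map_mul]; exact Ideal.mul_mem_mul (hsm u hu) (hsm v hv)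
    | add u _ v _ hu hv => rw [map_add]; exact add_mem hu hv
  have h1 : ∀ u, s u - u ∈ m ^ 2 := fun u => by
    convert! add_mem (hs2 _ (taylor_mem_sq a u)) (sum_mem (t := Finset.univ)
      fun i _ => Ideal.mul_mem_left (m ^ 2) (C (eval a (pderiv i u))) (hX i)) using 1
    have hC : ∀ c : K, s (C c) = C c := fun c => by simp [← MvPolynomial.algebraMap_eq]
    simp only [map_sub, map_sum, map_mul, hC, mul_sub, Finset.sum_sub_distrib]
    ring
  have hn : ∀ n : ℕ, ∀ u ∈ m ^ n, s u - u ∈ m ^ (n + 1) := fun n => by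
    induction n with
    | zero => exact fun u _ => Ideal.pow_le_pow_right (by norm_num) (h1 u)
    | succ n ih =>
      intro u hu
      rw [pow_succ] at hu
      induction hu using Submodule.mul_induction_on' with
      | mem_mul_mem u hu v hv =>
        have e : s (u * v) - u * v = (s u - u) * s v + u * (s v - v) := by rw [map_mul]; ring
        rw [e]
        refine add_mem ?_ ?_
        · rw [pow_succ]; exact Ideal.mul_mem_mul (ih u hu) (hsm v hv)
        · rw [show n + 1 + 1 = n + 2 from rfl, pow_add]; exact Ideal.mul_mem_mul hu (h1 v)
      | add u _ v _ hu hv =>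
        rw [map_add, add_sub_add_comm]; exact add_mem hu hv
  have hmem : ∀ n : ℕ, s f - f ∈ m ^ n := fun n => by
    induction n with
    | zero => simp
    | succ n ih =>
      have h := hn n _ ih
      rw [map_sub, hs] at h
      have e : s f - f = C (-(2 : K)⁻¹) * (f - s f - (s f - f)) := by
        have : C (-(2 : K)⁻¹) * (-2 : MvPolynomial σ K) = 1 := by
          rw [show (-2 : MvPolynomial σ K) = C (-2) by rw [map_neg, map_ofNat], ← C_mul]
          simp [h2]
        linear_combination (-(s f - f)) * this
      rw [e]
      exact Ideal.mul_mem_left _ _ h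
  have hne : m ≠ ⊤ := RingHom.ker_ne_top _
  have hbot := Ideal.iInf_pow_eq_bot_of_isDomain m hne
  have : s f - f ∈ (⨅ i : ℕ, m ^ i : Ideal (MvPolynomial σ K)) := by
    simpa only [Submodule.mem_iInf] using hmem
  rw [hbot] at this
  exact sub_eq_zero.mp this

open MvPolynomial in
/-- A finite `2`-group of polynomial automorphisms of affine space over a finite field of odd
characteristic embeds in the general linear group: it fixes a rational point, and acts faithfully
on the cotangent space there. -/
theorem exists_injective_GL_of_finite_field {K σ G : Type*} [Field K] [Finite K] [Fintype σ]
    [DecidableEq σ] [Group G] [Finite G] (hG : IsPGroup 2 G) (h2 : (2 : K) ≠ 0)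
    (r : G →* (MvPolynomial σ K →ₐ[K] MvPolynomial σ K)) (hr : Function.Injective r) :
    ∃ f : G →* GL σ K, Function.Injective f := by
  have hX : ∀ (g : G) (a : σ → K) (f : MvPolynomial σ K),
      eval (fun i => eval a (r g (X i))) f = eval a (r g f) := fun g a f => by
    have : (aeval (fun i => eval a (r g (X i))) : MvPolynomial σ K →ₐ[K] K) =
        (aeval a : MvPolynomial σ K →ₐ[K] K).comp (r g) := by
      ext i; simp [aeval_eq_eval]
    simpa [aeval_eq_eval] using DFunLike.congr_fun this f
  let _ : MulAction G (σ → K) :=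
    { smul := fun g a i => eval a (r g⁻¹ (X i))
      one_smul := fun a => by
        funext i
        change eval a (r 1⁻¹ (X i)) = a i
        simp
      mul_smul := fun g h a => by
        funext i
        change eval a (r (g * h)⁻¹ (X i)) =
          eval (fun i => eval a (r h⁻¹ (X i))) (r g⁻¹ (X i))
        rw [hX, mul_inv_rev, map_mul]
        rfl }
  have hodd : ¬ 2 ∣ Nat.card (σ → K) := by
    rw [Nat.card_fun]
    intro h
    have h := Nat.prime_two.dvd_of_dvd_pow h
    have := Fintype.ofFinite K
    rw [Nat.card_eq_fintype_card] at h
    have h0 : ((Fintype.card K : ℕ) : K) = 0 := Nat.cast_card_eq_zero K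
    obtain ⟨p, hp⟩ := CharP.exists K
    obtain ⟨n, hpp, hn⟩ := FiniteField.card K p
    rw [hn] at h
    have := (Nat.prime_dvd_prime_iff_eq Nat.prime_two hpp).mp (Nat.prime_two.dvd_of_dvd_pow h)
    subst this
    exact h2 (by exact_mod_cast CharP.cast_eq_zero K 2)
  obtain ⟨a, hfix⟩ := hG.nonempty_fixed_point_of_prime_not_dvd_card (σ → K) hodd
  have ha : ∀ (g : G) (f : MvPolynomial σ K), eval a (r g f) = eval a f := fun g f => by
    have h := hfix g⁻¹
    change (fun i => eval a (r g⁻¹⁻¹ (X i))) = a at h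
    rw [inv_inv] at h
    rw [← hX, h]
  let J : G →* Matrix σ σ K :=
    { toFun := fun g => Matrix.of fun j i => eval a (pderiv j (r g (X i)))
      map_one' := by
        ext j i
        simp [Matrix.one_apply, pderiv_X, Pi.single_apply, eq_comm, apply_ite (eval a)]
      map_mul' := fun g h => by
        ext j i
        rw [Matrix.mul_apply]
        simp only [Matrix.of_apply, map_mul]
        change eval a (pderiv j (r g (r h (X i)))) = _
        rw [pderiv_algHom, map_sum]
        refine Finset.sum_congr rfl fun k _ => ?_
        rw [map_mul, ha, mul_comm] }
  refine ⟨J.toHomUnits, ?_⟩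
  rw [← MonoidHom.ker_eq_bot_iff]
  by_contra hne
  have : Nontrivial J.toHomUnits.ker := (Subgroup.nontrivial_iff_ne_bot _).mpr hne
  have hp : IsPGroup 2 J.toHomUnits.ker := hG.to_subgroup _
  obtain ⟨n, hn, hc⟩ := hp.nontrivial_iff_card.mp this
  obtain ⟨⟨g, hg⟩, hgo⟩ := exists_prime_orderOf_dvd_card' (G := J.toHomUnits.ker) 2
    (hc ▸ dvd_pow_self 2 hn.ne')
  rw [Subgroup.orderOf_mk] at hgo
  have hg2 : g * g = 1 := by rw [← pow_two, ← hgo, pow_orderOf_eq_one]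
  have hJ : J g = 1 := by
    have := congrArg Units.val (MonoidHom.mem_ker.mp hg)
    simpa using this
  have hid : r g = r 1 := by
    refine AlgHom.ext fun f => ?_
    rw [map_one]
    refine algHom_eq_id_of_jacobian_eq_one h2 (r g) (fun f => ?_) a (ha g) (fun i j => ?_) f
    · change (r g * r g) f = f
      rw [← map_mul, hg2, map_one]; rfl
    · have := congrFun (congrFun hJ j) i
      simpa [J, Matrix.one_apply, eq_comm] using this
  have := hr hid
  rw [this] at hgo
  simp at hgo

open MvPolynomial in
/-- The reduction of a finite group of polynomial automorphisms over `ℚ` modulo all sufficiently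
large primes. -/
theorem exists_injective_reduction {σ : Type*} [Finite σ]
    (G : Subgroup (MvPolynomial σ ℚ ≃ₐ[ℚ] MvPolynomial σ ℚ)) [Finite G] :
    ∃ N : ℕ, ∀ p : ℕ, p.Prime → N < p →
      ∃ r : G →* (MvPolynomial σ (ZMod p) →ₐ[ZMod p] MvPolynomial σ (ZMod p)),
        Function.Injective r := by
  classical
  have hbd : ∀ f : MvPolynomial σ ℚ, ∃ N : ℕ, ∀ m,
      (coeff m f).den ≤ N + 1 ∧ (coeff m f).num.natAbs ≤ N + 1 := fun f => by
    refine ⟨f.support.sup fun m => max (coeff m f).den (coeff m f).num.natAbs, fun m => ?_⟩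
    by_cases hm : m ∈ f.support
    · have := Finset.le_sup (f := fun m => max (coeff m f).den (coeff m f).num.natAbs) hm
      exact (max_le_iff.mp (this.trans (Nat.le_succ _)))
    · rw [notMem_support_iff.mp hm]; simp
  choose B hB using hbd
  have := Fintype.ofFinite σ
  have := Fintype.ofFinite G
  let N : ℕ := (Finset.univ : Finset (G × σ)).sup fun x =>
    max (B (x.1.1 (X x.2))) (B (x.1.1 (X x.2) - X x.2))
  have hN : ∀ (g : G) (i : σ), B (g.1 (X i)) ≤ N ∧ B (g.1 (X i) - X i) ≤ N := fun g i => by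
    have := Finset.le_sup (f := fun x : G × σ =>
      max (B (x.1.1 (X x.2))) (B (x.1.1 (X x.2) - X x.2))) (Finset.mem_univ (g, i))
    exact max_le_iff.mp this
  refine ⟨N + 1, fun p hp hNp => ?_⟩
  have : Fact p.Prime := ⟨hp⟩
  let ι : ℤ_[p] →+* ℚ_[p] := PadicInt.Coe.ringHom
  have hι : Function.Injective ι := Subtype.coe_injective
  let κ : ℚ →+* ℚ_[p] := algebraMap ℚ ℚ_[p]
  have hP : ∀ (g : G) (i : σ), ∃ P : MvPolynomial σ ℤ_[p], map ι P = map κ (g.1 (X i)) :=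
    fun g i => by
      refine mem_range_map_iff_coeffs_subset.mpr fun c hc => ?_
      obtain ⟨m, -, rfl⟩ := mem_coeffs_iff.mp hc
      rw [coeff_map]
      refine ⟨⟨κ (coeff m (g.1 (X i))), ?_⟩, rfl⟩
      refine Padic.norm_rat_le_one fun hd => ?_
      have h1 := Nat.le_of_dvd (Rat.den_pos _) hd
      have h2 := (hB (g.1 (X i)) m).1
      have h3 := (hN g i).1
      omega
  choose P hP using hP
  have hmap : ∀ (g : G) (f : MvPolynomial σ ℚ),
      map κ (g.1 f) = bind₁ (fun i => map ι (P g i)) (map κ f) := fun g f => by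
    simp only [hP]
    rw [← map_bind₁]
    congr 1
    exact DFunLike.congr_fun (f := (g.1 : MvPolynomial σ ℚ →ₐ[ℚ] MvPolynomial σ ℚ))
      (by ext i; simp) f
  have hPmul : ∀ (g h : G) (i : σ), P (g * h) i = bind₁ (P g) (P h i) := fun g h i => by
    apply map_injective ι hι
    rw [hP, map_bind₁, hP h, ← hmap]
    rfl
  have hPone : ∀ i, P 1 i = X i := fun i => by
    apply map_injective ι hι
    rw [hP]
    simp
  let τ : ℤ_[p] →+* ZMod p := PadicInt.toZMod
  let r : G →* (MvPolynomial σ (ZMod p) →ₐ[ZMod p] MvPolynomial σ (ZMod p)) :=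
    { toFun := fun g => bind₁ fun i => map τ (P g i)
      map_one' := by
        ext i
        simp [hPone]
      map_mul' := fun g h => by
        refine MvPolynomial.algHom_ext fun i => ?_
        rw [bind₁_X_right, hPmul, map_bind₁]
        simp [AlgHom.mul_apply] }
  refine ⟨r, (injective_iff_map_eq_one r).mpr fun g hg => ?_⟩
  have hred : ∀ i, map τ (P g i - X i) = 0 := fun i => by
    have := DFunLike.congr_fun hg (X i)
    change bind₁ (fun i => map τ (P g i)) (X i) = X i at this
    rw [bind₁_X_right] at this
    rw [map_sub, this, map_X, sub_self]
  have hgX : ∀ i, g.1 (X i) = X i := fun i => by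
    rw [← sub_eq_zero]
    ext m
    rw [coeff_zero]
    set q := coeff m (g.1 (X i) - X i) with hq
    have hc : ι (coeff m (P g i - X i)) = (q : ℚ_[p]) := by
      rw [← coeff_map, map_sub, hP, map_X, ← map_X κ, ← map_sub, coeff_map]
      exact eq_ratCast κ _
    have hz : τ (coeff m (P g i - X i)) = 0 := by rw [← coeff_map, hred, coeff_zero]
    have hmul : coeff m (P g i - X i) * (q.den : ℤ_[p]) = (q.num : ℤ_[p]) := by
      apply hι
      rw [map_mul, hc, map_natCast, map_intCast]
      exact_mod_cast q.mul_den_eq_num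
    have hnum : ((q.num : ℤ) : ZMod p) = 0 := by
      rw [← map_intCast τ, ← hmul, map_mul, hz, zero_mul]
    rw [ZMod.intCast_zmod_eq_zero_iff_dvd, Int.natCast_dvd] at hnum
    by_contra hne
    have h1 := Nat.le_of_dvd (Int.natAbs_pos.mpr (Rat.num_ne_zero.mpr hne)) hnum
    have h2 : q.num.natAbs ≤ _ := (hB (g.1 (X i) - X i) m).2
    have h3 := (hN g i).2
    omega
  apply Subtype.ext
  refine AlgEquiv.ext fun f => ?_
  exact DFunLike.congr_fun (f := (g.1 : MvPolynomial σ ℚ →ₐ[ℚ] MvPolynomial σ ℚ))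
    (g := AlgHom.id ℚ _) (by ext i; simp [hgX]) f

/-- The action of the symmetric group on `ι → μ` permuting the coordinates. -/
def permCoordinates (ι μ : Type*) [CommGroup μ] : Equiv.Perm ι →* MulAut (ι → μ) where
  toFun s :=
    { toFun := fun u i => u (s⁻¹ i)
      invFun := fun u i => u (s i)
      left_inv := fun u => by ext i; simp
      right_inv := fun u => by ext i; simp
      map_mul' := fun _ _ => rfl }
  map_one' := rfl
  map_mul' := fun _ _ => rfl

/-- The wreath product `μ ≀ Perm ι` acts faithfully by monomial matrices over any field whose unit
group contains `μ`. -/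
theorem exists_injective_monomial {ι μ K : Type*} [Fintype ι] [DecidableEq ι] [CommGroup μ]
    [Field K] (χ : μ →* Kˣ) (hχ : Function.Injective χ) :
    ∃ f : (ι → μ) ⋊[permCoordinates ι μ] Equiv.Perm ι →* GL ι K, Function.Injective f := by
  let M : (ι → μ) ⋊[permCoordinates ι μ] Equiv.Perm ι →* Matrix ι ι K :=
    { toFun := fun w => Matrix.of fun i j => if i = w.right j then (χ (w.left i) : K) else 0
      map_one' := by
        ext i j
        simp [Matrix.one_apply]
      map_mul' := fun w v => by
        ext i j
        rw [Matrix.mul_apply]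
        simp only [Matrix.of_apply, mul_ite, mul_zero]
        rw [Finset.sum_ite_eq' Finset.univ (v.right j), if_pos (Finset.mem_univ _), ite_mul,
          zero_mul]
        by_cases h : i = w.right (v.right j)
        · subst h
          change (if w.right (v.right j) = (w.right * v.right) j then
            (χ ((w.left * permCoordinates ι μ w.right v.left) (w.right (v.right j))) : K)
            else 0) = _
          simp [permCoordinates]
        · rw [if_neg h]
          exact if_neg h }
  refine ⟨M.toHomUnits, (injective_iff_map_eq_one _).mpr fun w hw => ?_⟩
  have hM : M w = 1 := congrArg Units.val hw
  have hij : ∀ i j, (if i = w.right j then (χ (w.left i) : K) else 0) = if i = j then 1 else 0 :=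
    fun i j => by
      have := congrFun (congrFun hM i) j
      simpa [M, Matrix.one_apply] using this
  have hr : ∀ j, w.right j = j := fun j => by
    by_contra h
    have := hij (w.right j) j
    simp [h] at this
  refine SemidirectProduct.ext (funext fun i => hχ ?_) (Equiv.ext hr)
  have := hij i i
  simp only [hr, if_true] at this
  ext
  simpa using this

/-- A finite `p`-group inside `L` embeds into any group `W` embedded in `L` whose order has the
same `p`-part as that of `L`. -/
theorem exists_injective_of_padicValNat_eq {G W L : Type*} [Group G] [Group W] [Group L]
    [Finite L] (p : ℕ) [Fact p.Prime] (hG : IsPGroup p G)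
    (f : G →* L) (hf : Function.Injective f) (w : W →* L) (hw : Function.Injective w)
    (hcard : padicValNat p (Nat.card W) = padicValNat p (Nat.card L)) :
    ∃ h : G →* W, Function.Injective h := by
  have : Finite W := Finite.of_injective w hw
  obtain ⟨P⟩ : Nonempty (Sylow p W) := inferInstance
  let e := P.1.equivMapOfInjective w hw
  have hc : Nat.card (P.1.map w) = p ^ (Nat.card L).factorization p := by
    rw [← Nat.card_congr e.toEquiv, Nat.factorization_def _ Fact.out, ← hcard,
      ← Nat.factorization_def _ Fact.out]
    exact P.card_eq_multiplicity
  let Q : Sylow p L := Sylow.ofCard (P.1.map w) hc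
  obtain ⟨R, hR⟩ := (hG.of_surjective f.rangeRestrict f.rangeRestrict_surjective).exists_le_sylow
  let k : R ≃* P.1 := (R.equiv Q).trans e.symm
  refine ⟨P.1.subtype.comp (k.toMonoidHom.comp ((Subgroup.inclusion hR).comp f.rangeRestrict)), ?_⟩
  exact Subtype.coe_injective.comp (k.injective.comp
    ((Subgroup.inclusion_injective hR).comp (f.rangeRestrict_injective_iff.mpr hf)))

theorem IsPrimitiveRoot.exists_injective_units {K : Type*} [Field K] {n : ℕ} {z : K}
    (hz : IsPrimitiveRoot z n) (hn : n ≠ 0) :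
    ∃ χ : Multiplicative (ZMod n) →* Kˣ, Function.Injective χ := by
  have hu := hz.isUnit_unit' hn
  exact ⟨(Subgroup.subtype _).comp hu.zmodEquivZPowers.toMultiplicativeLeft.toMonoidHom,
    Subtype.coe_injective.comp (MulEquiv.injective _)⟩

theorem padicValNat_card_GL_s2 {K : Type*} [Field K] [Finite K] (d p : ℕ) [Fact p.Prime]
    (hp : ¬ p ∣ Nat.card K) :
    padicValNat p (Nat.card (GL (Fin d) K)) =
      ∑ j ∈ Finset.range d, padicValNat p (Nat.card K ^ (j + 1) - 1) := by
  have := Fintype.ofFinite K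
  have hq : 1 < Nat.card K := Finite.one_lt_card
  rw [Matrix.card_GL_field, ← Nat.card_eq_fintype_card,
    Fin.prod_univ_eq_prod_range (fun i => Nat.card K ^ d - Nat.card K ^ i),
    ← Finset.sum_range_reflect]
  have hne : ∀ i ∈ Finset.range d, Nat.card K ^ d - Nat.card K ^ i ≠ 0 := fun i hi =>
    (Nat.sub_pos_of_lt (Nat.pow_lt_pow_right hq (Finset.mem_range.mp hi))).ne'
  simp only [← Nat.factorization_def _ (Fact.out : p.Prime)]
  rw [Nat.factorization_prod_apply hne]
  simp only [Nat.factorization_def _ (Fact.out : p.Prime)]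
  refine Finset.sum_congr rfl fun i hi => ?_
  have hi' := Finset.mem_range.mp hi
  have e : Nat.card K ^ d - Nat.card K ^ i =
      Nat.card K ^ i * (Nat.card K ^ (d - 1 - i + 1) - 1) := by
    rw [Nat.mul_sub, ← pow_add, mul_one]
    congr 2
    omega
  rw [e, padicValNat.mul (by positivity), padicValNat.eq_zero_of_not_dvd, zero_add]
  · exact fun h => hp (Nat.Prime.dvd_of_dvd_pow Fact.out h)
  · exact fun h => hne i hi (by rw [e, h, mul_zero])

theorem padicValNat_two_eq_one {m : ℕ} (h : m % 4 = 2) : padicValNat 2 m = 1 := by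
  obtain ⟨k, rfl⟩ : 2 ∣ m := by omega
  rw [padicValNat.mul two_ne_zero (by omega), padicValNat_self,
    padicValNat.eq_zero_of_not_dvd (n := k) (by omega)]

theorem padicValNat_two_eq_two {m : ℕ} (h : m % 8 = 4) : padicValNat 2 m = 2 := by
  obtain ⟨k, rfl⟩ : 2 ∣ m := by omega
  rw [padicValNat.mul two_ne_zero (by omega), padicValNat_self, padicValNat_two_eq_one (by omega)]

theorem pow_mod_eight_of_odd {q n : ℕ} (hq : q % 2 = 1) (hn : Odd n) : q ^ n % 8 = q % 8 := by
  obtain ⟨k, rfl⟩ := hn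
  have h1 : q ^ 2 % 8 = 1 := by
    have : q % 8 = 1 ∨ q % 8 = 3 ∨ q % 8 = 5 ∨ q % 8 = 7 := by omega
    rcases this with h | h | h | h <;> simp [Nat.pow_mod, h]
  rw [pow_succ, pow_mul, Nat.mul_mod, Nat.pow_mod, h1]
  simp

theorem sum_padicValNat_two_of_mod_eight_eq_five {q : ℕ} (hq : q % 8 = 5) (d : ℕ) :
    ∑ j ∈ Finset.range d, padicValNat 2 (q ^ (j + 1) - 1) =
      2 * d + padicValNat 2 d.factorial := by
  induction d with
  | zero => simp
  | succ d ih =>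
    rw [Finset.sum_range_succ, ih, Nat.factorial_succ,
      padicValNat.mul (by omega) (Nat.factorial_ne_zero d)]
    rcases Nat.even_or_odd (d + 1) with h | h
    · have h1 := padicValNat.pow_two_sub_one (x := q) (by omega) (by omega) d.succ_ne_zero h
      rw [padicValNat_two_eq_one (m := q + 1) (by omega),
        padicValNat_two_eq_two (m := q - 1) (by omega)] at h1
      simp only [Nat.succ_eq_add_one] at h1
      omega
    · have h1 := pow_mod_eight_of_odd (q := q) (by omega) h
      rw [padicValNat_two_eq_two (m := q ^ (d + 1) - 1) (by omega),
        padicValNat.eq_zero_of_not_dvd (n := d + 1) (by grind)]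
      omega

theorem sum_padicValNat_two_of_mod_eight_eq_three {q : ℕ} (hq : q % 8 = 3) (d : ℕ) :
    ∑ j ∈ Finset.range d, padicValNat 2 (q ^ (j + 1) - 1) =
      d + padicValNat 2 d.factorial + d / 2 := by
  induction d with
  | zero => simp
  | succ d ih =>
    rw [Finset.sum_range_succ, ih, Nat.factorial_succ,
      padicValNat.mul (by omega) (Nat.factorial_ne_zero d)]
    rcases Nat.even_or_odd (d + 1) with h | h
    · have h1 := padicValNat.pow_two_sub_one (x := q) (by omega) (by omega) d.succ_ne_zero h
      rw [padicValNat_two_eq_two (m := q + 1) (by omega),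
        padicValNat_two_eq_one (m := q - 1) (by omega)] at h1
      simp only [Nat.succ_eq_add_one] at h1
      grind
    · have h1 := pow_mod_eight_of_odd (q := q) (by omega) h
      rw [padicValNat_two_eq_one (m := q ^ (d + 1) - 1) (by omega),
        padicValNat.eq_zero_of_not_dvd (n := d + 1) (by grind)]
      grind

theorem padicValNat_two_factorial_eq_sum (d : ℕ) :
    padicValNat 2 d.factorial = ∑ k ∈ Finset.range d, d / 2 ^ (k + 1) := by
  rw [padicValNat_factorial (b := d + 1), Finset.sum_Ico_eq_sum_range]
  · simp [add_comm]
  · exact Nat.lt_succ_of_le (Nat.log_le_self 2 d)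

/-- Let `G` be a finite `2`-subgroup of the group of polynomial automorphisms of affine
`d`-space over `ℚ`. Then `G` embeds into `GL_d(ℚ(i))` where `ℚ(i)` is the fourth cyclotomic
field, and consequently `v_2(|G|) ≤ M_ℚ(d,2) + ⌊d/2⌋` where `M_ℚ(d,2) = d + ∑_{k≥1} ⌊d/2^k⌋`. -/
theorem two_group_polynomial_automorphisms (d : ℕ)
    (G : Subgroup (MvPolynomial (Fin d) ℚ ≃ₐ[ℚ] MvPolynomial (Fin d) ℚ))
    (hG : Finite G) (hcard : ∃ α : ℕ, Nat.card G = 2 ^ α) :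
    (∃ f : G →* GL (Fin d) (CyclotomicField 4 ℚ), Function.Injective f) ∧
      padicValNat 2 (Nat.card G) ≤
        (d + ∑ k ∈ Finset.range d, d / 2 ^ (k + 1)) + d / 2 := by
  have hG2 : IsPGroup 2 G := IsPGroup.iff_card.mpr hcard
  obtain ⟨N, hN⟩ := exists_injective_reduction G
  have hGL : ∀ p : ℕ, p.Prime → N < p → 2 < p →
      ∃ f : G →* GL (Fin d) (ZMod p), Function.Injective f := fun p hp hNp h2p => by
    have : Fact p.Prime := ⟨hp⟩
    obtain ⟨r, hr⟩ := hN p hp hNp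
    refine exists_injective_GL_of_finite_field hG2 (fun h => ?_) r hr
    have h := (ZMod.natCast_eq_zero_iff 2 p).mp (by exact_mod_cast h)
    exact absurd (Nat.le_of_dvd two_pos h) (by omega)
  constructor
  · obtain ⟨p, hNp, hp, hp8⟩ := Nat.forall_exists_prime_gt_and_modEq (max N 2)
      (q := 8) (a := 5) (by norm_num) (by norm_num)
    have : Fact p.Prime := ⟨hp⟩
    have hp5 : p % 8 = 5 := hp8
    obtain ⟨f, hf⟩ := hGL p hp (by omega) (by omega)
    obtain ⟨y, hy⟩ := ZMod.exists_sq_eq_neg_one_iff.mpr (show p % 4 ≠ 3 by omega)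
    have hy4 : IsPrimitiveRoot y 4 := by
      have h : orderOf y = 2 ^ (1 + 1) := orderOf_eq_prime_pow
        (fun h => ?_) (by linear_combination (1 - y * y) * hy)
      · simpa [h] using IsPrimitiveRoot.orderOf y
      · have h0 : (2 : ZMod p) = 0 := by linear_combination -h - hy
        have h0 := (ZMod.natCast_eq_zero_iff 2 p).mp (by exact_mod_cast h0)
        exact absurd (Nat.le_of_dvd two_pos h0) (by omega)
    obtain ⟨χ, hχ⟩ := hy4.exists_injective_units (by norm_num)
    obtain ⟨z, hz⟩ := ((isCyclotomicExtension_iff _ _ _).mp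
      (CyclotomicField.isCyclotomicExtension 4 ℚ)).1 (Set.mem_singleton 4) (by norm_num)
    obtain ⟨χ', hχ'⟩ := hz.exists_injective_units (by norm_num)
    obtain ⟨w, hw⟩ := exists_injective_monomial (ι := Fin d) χ hχ
    obtain ⟨w', hw'⟩ := exists_injective_monomial (ι := Fin d) χ' hχ'
    have h4 : padicValNat 2 (4 ^ d) = 2 * d := by
      rw [show (4 : ℕ) ^ d = 2 ^ (2 * d) by rw [pow_mul]; norm_num]
      exact padicValNat.prime_pow _
    obtain ⟨h, hh⟩ := exists_injective_of_padicValNat_eq 2 hG2 f hf w hw (by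
      rw [padicValNat_card_GL_s2 d 2 (by rw [Nat.card_zmod]; omega), Nat.card_zmod,
        sum_padicValNat_two_of_mod_eight_eq_five hp5,
        Nat.card_congr SemidirectProduct.equivProd, Nat.card_prod, Nat.card_perm, Nat.card_fun,
        Nat.card_congr Multiplicative.toAdd, Nat.card_zmod, Nat.card_fin,
        padicValNat.mul (by positivity) (Nat.factorial_ne_zero d)]
      exact congrArg (· + _) h4)
    exact ⟨w'.comp h, hw'.comp hh⟩
  · obtain ⟨p, hNp, hp, hp8⟩ := Nat.forall_exists_prime_gt_and_modEq (max N 2)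
      (q := 8) (a := 3) (by norm_num) (by norm_num)
    have : Fact p.Prime := ⟨hp⟩
    have hp3 : p % 8 = 3 := hp8
    obtain ⟨f, hf⟩ := hGL p hp (by omega) (by omega)
    have hdvd := Subgroup.card_dvd_of_injective f hf
    refine (padicValNat_dvd_iff_le (p := 2) Nat.card_pos.ne').mp
      (pow_padicValNat_dvd.trans hdvd) |>.trans_eq ?_
    rw [padicValNat_card_GL_s2 d 2 (by rw [Nat.card_zmod]; omega), Nat.card_zmod,
      sum_padicValNat_two_of_mod_eight_eq_three hp3, padicValNat_two_factorial_eq_sum]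
end

section
/- Let G be a finite subgroup of GL_d(ℚ). There exists a natural number N such that for every prime ℓ > N there is an injective group homomorphism G → GL_d(F_ℓ). -/
/-- The subring of rationals whose denominator is prime to `p`. -/
def Rat.primeToSubring (p : ℕ) [Fact p.Prime] : Subring ℚ where
  carrier := {q | (q.den : ZMod p) ≠ 0}
  zero_mem' := by simp
  one_mem' := by simp
  add_mem' {a b} ha hb h := by
    have hd := (Nat.cast_dvd_cast (α := ZMod p) (Rat.add_den_dvd a b))
    rw [h, zero_dvd_iff, Nat.cast_mul] at hd
    exact mul_ne_zero ha hb hd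
  mul_mem' {a b} ha hb h := by
    have hd := (Nat.cast_dvd_cast (α := ZMod p) (Rat.mul_den_dvd a b))
    rw [h, zero_dvd_iff, Nat.cast_mul] at hd
    exact mul_ne_zero ha hb hd
  neg_mem' {a} ha := by simpa using ha

/-- Reduction modulo `p` of the rationals whose denominator is prime to `p`. -/
def Rat.primeToReduction (p : ℕ) [Fact p.Prime] : Rat.primeToSubring p →+* ZMod p where
  toFun q := ((q : ℚ) : ZMod p)
  map_zero' := by simp
  map_one' := by simp
  map_add' a b := by simpa using Rat.cast_add_of_ne_zero a.2 b.2
  map_mul' a b := by simpa using Rat.cast_mul_of_ne_zero a.2 b.2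

theorem Rat.natCast_den_ne_zero_of_lt {p : ℕ} {q : ℚ} (h : q.den < p) :
    (q.den : ZMod p) ≠ 0 := by
  rw [Ne, ZMod.natCast_eq_zero_iff]
  exact fun hd => (Nat.le_of_dvd q.den_pos hd).not_gt h

theorem Rat.eq_zero_of_primeToReduction_eq_zero {p : ℕ} [Fact p.Prime]
    {q : Rat.primeToSubring p} (h : (q : ℚ).num.natAbs < p)
    (hq : Rat.primeToReduction p q = 0) : q = 0 := by
  have hq' : ((q : ℚ) : ZMod p) = 0 := hq
  rw [Rat.cast_def, div_eq_zero_iff, or_iff_left q.2, ZMod.intCast_zmod_eq_zero_iff_dvd,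
    Int.natCast_dvd] at hq'
  have h_num := Nat.eq_zero_of_dvd_of_lt hq' h
  exact Subtype.ext (by simpa using h_num)

/-- Let `G` be a finite subgroup of `GL_d(ℚ)`. There exists `N` such that for every prime
`ℓ > N` there is an injective group homomorphism `G → GL_d(F_ℓ)`. -/
theorem embedding_finite_subgroup_mod_ell (d : ℕ)
    (G : Subgroup (GL (Fin d) ℚ)) (hG : Finite G) :
    ∃ N : ℕ, ∀ ℓ : ℕ, N < ℓ → ℓ.Prime →
      ∃ f : G →* GL (Fin d) (ZMod ℓ), Function.Injective f := by
  obtain ⟨N₁, hN₁⟩ := Finite.exists_le fun x : G × Fin d × Fin d => (x.1.1 x.2.1 x.2.2).den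
  obtain ⟨N₂, hN₂⟩ := Finite.exists_le fun x : G × G × Fin d × Fin d =>
    (x.1.1 x.2.2.1 x.2.2.2 - x.2.1.1 x.2.2.1 x.2.2.2).num.natAbs
  refine ⟨max N₁ N₂, fun ℓ hN hℓ => ?_⟩
  have : Fact ℓ.Prime := ⟨hℓ⟩
  have h_mem (g : G) (i j : Fin d) : g.1 i j ∈ Rat.primeToSubring ℓ :=
    Rat.natCast_den_ne_zero_of_lt
      ((hN₁ (g, i, j)).trans_lt ((le_max_left _ _).trans_lt hN))
  let A : G →* Matrix (Fin d) (Fin d) (Rat.primeToSubring ℓ) :=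
    { toFun g := Matrix.of fun i j => ⟨g.1 i j, h_mem g i j⟩
      map_one' := by
        ext i j
        by_cases h : i = j <;> simp [Matrix.one_apply, h]
      map_mul' g h := by
        ext i j
        simp [Matrix.mul_apply] }
  let f : G →* Matrix (Fin d) (Fin d) (ZMod ℓ) :=
    (Rat.primeToReduction ℓ).mapMatrix.toMonoidHom.comp A
  refine ⟨f.toHomUnits, fun g h hgh => ?_⟩
  have h_map : f g = f h := Units.ext_iff.mp hgh
  have h_red (i j : Fin d) : Rat.primeToReduction ℓ (A g i j) = Rat.primeToReduction ℓ (A h i j) :=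
    congrFun (congrFun h_map i) j
  ext i j
  have h_zero : A g i j - A h i j = 0 :=
    Rat.eq_zero_of_primeToReduction_eq_zero
      ((hN₂ (g, h, i, j)).trans_lt ((le_max_right _ _).trans_lt hN))
      (by rw [map_sub, h_red, sub_self])
  exact congrArg Subtype.val (sub_eq_zero.mp h_zero)
end

section
/- Let d be a natural number and p a prime. Let F be a finite field of characteristic different from p, and let G be a finite p-subgroup of Aut(A^d_F). Then there exists a point x₀ ∈ F^d fixed by every element of G (i.e., for all g ∈ G and all i, evaluating the polynomial g(x_i) at x₀ gives the i-th coordinate of x₀), and the map sending g ∈ G to its Jacobian matrix at x₀ — the d×d matrix whose (i,j) entry is the j-th partial derivative of the polynomial g(x_i) evaluated at x₀ — is injective on G. -/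
open MvPolynomial in
theorem MvPolynomial.sub_taylor_one_mem_ker_eval_sq {σ R : Type*} [Fintype σ] [CommRing R]
    (x : σ → R) (f : MvPolynomial σ R) :
    f - C (eval x f) - ∑ j, C (eval x (pderiv j f)) * (X j - C (x j)) ∈
      RingHom.ker (eval x) ^ 2 := by
  classical
  induction f using MvPolynomial.induction_on with
  | C a => simp
  | add f g hf hg =>
    convert add_mem hf hg using 1
    simp only [map_add, add_mul, Finset.sum_add_distrib]
    ring
  | mul_X f i hf =>
    have h₁ : (f - C (eval x f)) * (X i - C (x i)) ∈ RingHom.ker (eval x) ^ 2 := by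
      rw [pow_two]
      exact Ideal.mul_mem_mul (by simp [RingHom.mem_ker]) (by simp [RingHom.mem_ker])
    convert add_mem (Ideal.mul_mem_left _ (C (x i)) hf) h₁ using 1
    have h₂ : ∑ j, C (eval x (pderiv j (f * X i))) * (X j - C (x j)) =
        C (x i) * ∑ j, C (eval x (pderiv j f)) * (X j - C (x j)) +
          C (eval x f) * (X i - C (x i)) := by
      have h₃ : C (eval x f) * (X i - C (x i)) =
          ∑ j, if j = i then C (eval x f) * (X j - C (x j)) else 0 := by simp
      rw [h₃, Finset.mul_sum, ← Finset.sum_add_distrib]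
      refine Finset.sum_congr rfl fun j _ => ?_
      by_cases hj : j = i
      · subst hj
        simp [Derivation.leibniz]
        ring
      · simp [Derivation.leibniz, pderiv_X_of_ne (Ne.symm hj), hj]
        ring
    rw [h₂]
    simp only [map_mul, eval_X]
    ring

open MvPolynomial in
/-- Two algebra endomorphisms agreeing modulo an ideal on the variables agree modulo it. -/
theorem MvPolynomial.algHom_sub_mem_of_X {σ R S : Type*} [CommRing R] [CommRing S] [Algebra R S]
    (g h : MvPolynomial σ R →ₐ[R] S) (I : Ideal S) (H : ∀ i, g (X i) - h (X i) ∈ I)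
    (f : MvPolynomial σ R) : g f - h f ∈ I := by
  have : (Ideal.Quotient.mkₐ R I).comp g = (Ideal.Quotient.mkₐ R I).comp h :=
    algHom_ext fun i => Ideal.Quotient.eq.2 (H i)
  exact Ideal.Quotient.eq.1 (DFunLike.congr_fun this f)

/-- An endomorphism congruent to the identity modulo `m ^ 2` acts trivially on the graded pieces
`m ^ n / m ^ (n + 1)`. -/
theorem Ideal.map_sub_self_mem_pow_succ {A : Type*} [CommRing A] (m : Ideal A) (k : A →+* A)
    (hk : ∀ f, k f - f ∈ m ^ 2) (n : ℕ) {y : A} (hy : y ∈ m ^ n) : k y - y ∈ m ^ (n + 1) := by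
  induction n generalizing y with
  | zero => exact Ideal.pow_le_pow_right (by norm_num) (hk y)
  | succ n ih =>
    rw [pow_succ] at hy
    induction hy using Submodule.mul_induction_on' with
    | mem_mul_mem a ha b hb =>
      have hkb : k b ∈ m := by
        simpa using add_mem (Ideal.pow_le_self two_ne_zero (hk b)) hb
      have h₁ : (k a - a) * k b ∈ m ^ (n + 1 + 1) := by
        rw [pow_succ]
        exact Ideal.mul_mem_mul (ih ha) hkb
      have h₂ : a * (k b - b) ∈ m ^ (n + 1 + 1) := by
        rw [add_assoc, pow_add]
        exact Ideal.mul_mem_mul ha (hk b)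
      convert add_mem h₁ h₂ using 1
      rw [map_mul]
      ring
    | add a _ b _ ha hb =>
      convert add_mem ha hb using 1
      rw [map_add]
      ring

/-- A ring endomorphism of finite order invertible in `A`, congruent to the identity modulo
`m ^ 2` for a proper ideal `m` of a Noetherian domain `A`, is the identity. -/
theorem Ideal.eq_self_of_iterate_eq_of_sub_mem_sq {A : Type*} [CommRing A] [IsDomain A]
    [IsNoetherianRing A] (m : Ideal A) (hm : m ≠ ⊤) (k : A →+* A)
    (hk : ∀ f, k f - f ∈ m ^ 2) (N : ℕ) (hN : IsUnit (N : A)) (hkN : ∀ f, k^[N] f = f) (f : A) :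
    k f = f := by
  have key (n : ℕ) : ∀ f, k f - f ∈ m ^ n := by
    induction n with
    | zero => simp
    | succ n ih =>
      intro f
      have step (j : ℕ) : k^[j] f - f - j * (k f - f) ∈ m ^ (n + 1) := by
        induction j with
        | zero => simp
        | succ j hj =>
          have h₁ : k^[j] f - f ∈ m ^ n := by
            convert add_mem (Ideal.pow_le_pow_right n.le_succ hj)
              (Ideal.mul_mem_left _ (j : A) (ih f)) using 1
            ring
          convert add_mem (m.map_sub_self_mem_pow_succ k hk n h₁) hj using 1
          rw [Function.iterate_succ_apply', map_sub]
          push_cast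
          ring
      have h := step N
      rw [hkN, sub_self, zero_sub, neg_mem_iff] at h
      exact (Ideal.unit_mul_mem_iff_mem _ hN).1 h
  have h : k f - f ∈ ⨅ n : ℕ, m ^ n := (Submodule.mem_iInf _).2 fun n => key n f
  rw [Ideal.iInf_pow_eq_bot_of_isDomain m hm, Ideal.mem_bot] at h
  exact sub_eq_zero.1 h

open MvPolynomial in
/-- The action of polynomial automorphisms on points, made into a left action by inversion. -/
@[reducible]
noncomputable def MvPolynomial.pointsMulAction {σ R : Type*} [CommRing R]
    (G : Subgroup (MvPolynomial σ R ≃ₐ[R] MvPolynomial σ R)) : MulAction G (σ → R) where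
  smul g a i := eval a ((g : MvPolynomial σ R ≃ₐ[R] MvPolynomial σ R)⁻¹ (X i))
  one_smul a := by
    funext i
    change eval a ((((1 : G) : MvPolynomial σ R ≃ₐ[R] MvPolynomial σ R))⁻¹ (X i)) = a i
    simp
  mul_smul g h a := by
    funext i
    change eval a (((g * h : G) : MvPolynomial σ R ≃ₐ[R] MvPolynomial σ R)⁻¹ (X i)) =
      eval (fun j => eval a ((h : MvPolynomial σ R ≃ₐ[R] MvPolynomial σ R)⁻¹ (X j)))
        ((g : MvPolynomial σ R ≃ₐ[R] MvPolynomial σ R)⁻¹ (X i))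
    have H : (aeval a : MvPolynomial σ R →ₐ[R] R).comp
        ((h : MvPolynomial σ R ≃ₐ[R] MvPolynomial σ R)⁻¹ :
          MvPolynomial σ R ≃ₐ[R] MvPolynomial σ R).toAlgHom =
        aeval (fun j => eval a ((h : MvPolynomial σ R ≃ₐ[R] MvPolynomial σ R)⁻¹ (X j))) := by
      ext i
      simp [aeval_eq_eval]
    have H' := DFunLike.congr_fun H ((g : MvPolynomial σ R ≃ₐ[R] MvPolynomial σ R)⁻¹ (X i))
    rw [Subgroup.coe_mul, mul_inv_rev]
    simpa [aeval_eq_eval] using H'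


/-- Let `F` be a finite field of characteristic different from `p` and `G` a finite
`p`-subgroup of the group of polynomial automorphisms of affine `d`-space over `F`.
Then `G` has a fixed point `x₀ ∈ Fᵈ`, and the map sending `g ∈ G` to its Jacobian matrix
at `x₀` is injective. -/
theorem fixed_point_and_injective_differential (d p : ℕ) (hp : p.Prime)
    (F : Type*) [Field F] [Fintype F] (hchar : ringChar F ≠ p)
    (G : Subgroup (MvPolynomial (Fin d) F ≃ₐ[F] MvPolynomial (Fin d) F))
    (hG : Finite G) (hcard : ∃ α : ℕ, Nat.card G = p ^ α) :
    ∃ x₀ : Fin d → F,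
      (∀ g ∈ G, ∀ i : Fin d, MvPolynomial.eval x₀ (g (MvPolynomial.X i)) = x₀ i) ∧
      Function.Injective (fun g : G =>
        Matrix.of (fun i j : Fin d =>
          MvPolynomial.eval x₀
            (MvPolynomial.pderiv j
              ((g : MvPolynomial (Fin d) F ≃ₐ[F] MvPolynomial (Fin d) F)
                (MvPolynomial.X i))))) := by
  classical
  obtain ⟨α, hα⟩ := hcard
  have : Fact p.Prime := ⟨hp⟩
  have hF : Fact (ringChar F).Prime :=
    ⟨(CharP.char_is_prime_or_zero F (ringChar F)).resolve_right
      (CharP.char_ne_zero_of_finite F (ringChar F))⟩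
  have hpF : (p : F) ≠ 0 := fun h =>
    hchar ((Nat.prime_dvd_prime_iff_eq hF.out hp).1 (ringChar.dvd h))
  have hcardF : ¬ p ∣ Nat.card (Fin d → F) := by
    intro h
    rw [Nat.card_fun, Nat.card_eq_fintype_card] at h
    obtain ⟨n, -, hn⟩ := FiniteField.card F (ringChar F)
    rw [hn] at h
    have h' := hp.dvd_of_dvd_pow (hp.dvd_of_dvd_pow h)
    exact hchar ((Nat.prime_dvd_prime_iff_eq hp hF.out).1 h').symm
  let _ := MvPolynomial.pointsMulAction G
  obtain ⟨x₀, hx₀⟩ := (IsPGroup.of_card hα).nonempty_fixed_point_of_prime_not_dvd_card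
    (Fin d → F) hcardF
  have hfix : ∀ g ∈ G, ∀ i : Fin d, MvPolynomial.eval x₀ (g (MvPolynomial.X i)) = x₀ i := by
    intro g hg i
    have h : MvPolynomial.eval x₀ ((g⁻¹)⁻¹ (MvPolynomial.X i)) = x₀ i :=
      congrFun (hx₀ ⟨g⁻¹, G.inv_mem hg⟩) i
    rwa [inv_inv] at h
  refine ⟨x₀, hfix, ?_⟩
  rintro ⟨g, hg⟩ ⟨h, hh⟩ hgh
  have hJ (i j : Fin d) := congrFun (congrFun hgh i) j
  simp only [Matrix.of_apply] at hJ
  set m := RingHom.ker (MvPolynomial.eval x₀) with hm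
  have hX (i : Fin d) : g (MvPolynomial.X i) - h (MvPolynomial.X i) ∈ m ^ 2 := by
    simpa [hfix g hg i, hfix h hh i, hJ] using
      MvPolynomial.sub_taylor_one_mem_ker_eval_sq x₀ (g (MvPolynomial.X i) - h (MvPolynomial.X i))
  have hsq (f) : g f - h f ∈ m ^ 2 :=
    MvPolynomial.algHom_sub_mem_of_X g.toAlgHom h.toAlgHom (m ^ 2) hX f
  have hpow : (g * h⁻¹) ^ (p ^ α) = 1 := by
    have := pow_card_eq_one' (x := (⟨g * h⁻¹, G.mul_mem hg (G.inv_mem hh)⟩ : G))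
    rw [hα] at this
    exact congrArg Subtype.val this
  have hiter (n : ℕ) (f) : (g * h⁻¹ : _ ≃ₐ[F] _)^[n] f = ((g * h⁻¹) ^ n) f := by
    induction n with
    | zero => rfl
    | succ n ih => rw [Function.iterate_succ_apply', ih, pow_succ']; rfl
  have hunit : IsUnit ((p ^ α : ℕ) : MvPolynomial (Fin d) F) := by
    have := (IsUnit.mk0 _ (pow_ne_zero α hpF)).map (MvPolynomial.C (σ := Fin d))
    simpa using this
  have hone : g * h⁻¹ = 1 := by
    ext1 f
    refine m.eq_self_of_iterate_eq_of_sub_mem_sq (RingHom.ker_ne_top _)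
      ((g * h⁻¹ : _ ≃ₐ[F] _) : MvPolynomial (Fin d) F →+* MvPolynomial (Fin d) F)
      (fun f => ?_) (p ^ α) hunit (fun f => ?_) f
    · have := hsq (h⁻¹ f)
      rwa [← AlgEquiv.mul_apply h, mul_inv_cancel] at this
    · exact (hiter _ f).trans (by rw [hpow]; rfl)
  exact Subtype.ext (mul_inv_eq_one.1 hone)
end

section
/- Let d ≥ 1 and let a : (Fin d →₀ ℕ) → ℚ_p be a family of coefficients such that ‖a_I‖ → 0 as I → ∞ (i.e., the function I ↦ ‖a_I‖ tends to 0 along the cofinite filter). Define F : ℤ_p^d → ℚ_p by F(x) = ∑'_I a_I · ∏_i x_i^{I_i} (a convergent sum since ℚ_p is complete and nonarchimedean). If there exists a nonempty open subset U of ℤ_p^d such that F vanishes identically on U, then all coefficients a_I are zero. -/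
open Filter Topology in
/-- A family tending to zero, multiplied termwise by elements of norm at most one, is summable. -/
lemma summable_mul_of_tendsto_zero {K ι : Type*} [NormedField K] [CompleteSpace K]
    [IsUltrametricDist K] {a w : ι → K} (ha : Tendsto a cofinite (𝓝 0)) (hw : ∀ i, ‖w i‖ ≤ 1) :
    Summable fun i => a i * w i := by
  refine NonarchimedeanAddGroup.summable_of_tendsto_cofinite_zero ?_
  refine squeeze_zero_norm (fun i => ?_) (tendsto_zero_iff_norm_tendsto_zero.1 ha)
  rw [norm_mul]
  exact mul_le_of_le_one_right (norm_nonneg _) (hw i)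

open Filter Topology in
/-- A convergent power series on the closed unit disc vanishing at `u` factors through `x - u`;
the coefficients of the quotient also tend to zero, and are bounded by the tails of the
original ones. -/
lemma exists_quotient_of_tsum_eq_zero {K : Type*} [NormedField K] [CompleteSpace K]
    [IsUltrametricDist K] {b : ℕ → K} (hb : Tendsto b cofinite (𝓝 0)) {u : K} (hu : ‖u‖ ≤ 1)
    (h0 : ∑' n, b n * u ^ n = 0) :
    ∃ g : ℕ → K, Tendsto g cofinite (𝓝 0) ∧ (∀ n, g n = b (n + 1) + u * g (n + 1)) ∧
      (∀ n r, (∀ k, n < k → ‖b k‖ ≤ r) → ‖g n‖ ≤ r) ∧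
      ∀ x : K, ‖x‖ ≤ 1 → ∑' n, b n * x ^ n = (x - u) * ∑' n, g n * x ^ n := by
  have hpow : ∀ x : K, ‖x‖ ≤ 1 → ∀ n, ‖x ^ n‖ ≤ 1 := fun x hx n => by
    rw [norm_pow]; exact pow_le_one₀ (norm_nonneg _) hx
  have hshift : ∀ m, Tendsto (fun n => b (n + m)) cofinite (𝓝 0) := fun m => by
    rw [Nat.cofinite_eq_atTop] at hb ⊢
    exact hb.comp (tendsto_add_atTop_nat m)
  obtain ⟨g, hg⟩ : ∃ g : ℕ → K, ∀ n, g n = ∑' j, b (j + (n + 1)) * u ^ j := ⟨_, fun _ => rfl⟩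
  have hbound : ∀ n r, (∀ k, n < k → ‖b k‖ ≤ r) → ‖g n‖ ≤ r := fun n r h => by
    rw [hg]
    refine IsUltrametricDist.norm_tsum_le_of_forall_le fun j => ?_
    rw [norm_mul]
    exact (mul_le_of_le_one_right (norm_nonneg _) (hpow u hu j)).trans (h _ (by omega))
  have hstep : ∀ m, ∑' j, b (j + m) * u ^ j = b m + u * ∑' j, b (j + (m + 1)) * u ^ j := fun m => by
    rw [(summable_mul_of_tendsto_zero (hshift m) (hpow u hu)).tsum_eq_zero_add, ← tsum_mul_left]
    simp only [zero_add, pow_zero, mul_one, pow_succ, add_assoc, add_comm 1 m]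
    congr 1
    exact tsum_congr fun j => by ring
  have hrec : ∀ n, g n = b (n + 1) + u * g (n + 1) := fun n => by
    rw [hg, hg]; exact hstep (n + 1)
  have hrec0 : b 0 + u * g 0 = 0 := by
    rw [← h0, hg]; exact (hstep 0).symm
  have hgt : Tendsto g cofinite (𝓝 0) := by
    rw [Nat.cofinite_eq_atTop] at hb ⊢
    rw [Metric.tendsto_atTop] at hb ⊢
    intro ε hε
    obtain ⟨M, hM⟩ := hb (ε / 2) (half_pos hε)
    refine ⟨M, fun n hn => ?_⟩
    rw [dist_zero_right]
    refine (hbound n (ε / 2) fun k hk => ?_).trans_lt (half_lt_self hε)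
    simpa using (hM k (by omega)).le
  refine ⟨g, hgt, hrec, hbound, fun x hx => ?_⟩
  have hsg := summable_mul_of_tendsto_zero hgt (hpow x hx)
  have hsg' : Summable fun n => g (n + 1) * x ^ (n + 1) := 
    (summable_nat_add_iff (f := fun n => g n * x ^ n) 1).2 hsg
  rw [(summable_mul_of_tendsto_zero hb (hpow x hx)).tsum_eq_zero_add]
  have : ∀ n, b (n + 1) * x ^ (n + 1) = x * (g n * x ^ n) - u * (g (n + 1) * x ^ (n + 1)) :=
    fun n => by rw [hrec n]; ring
  rw [tsum_congr this, (hsg.mul_left x).tsum_sub (hsg'.mul_left u), tsum_mul_left, tsum_mul_left,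
    sub_mul, hsg.tsum_eq_zero_add]
  linear_combination hrec0

open Filter Topology in
/-- Weak form of Strassmann's theorem: if some coefficient strictly dominates all later ones,
the power series has finitely many zeros in the closed unit disc. -/
lemma finite_zeros_of_dominant_coeff {K : Type*} [NormedField K] [CompleteSpace K]
    [IsUltrametricDist K] (N : ℕ) {b : ℕ → K} (hb : Tendsto b cofinite (𝓝 0)) {r : ℝ}
    (hN : r < ‖b N‖) (hr : ∀ n, N < n → ‖b n‖ ≤ r) :
    {x : K | ‖x‖ ≤ 1 ∧ ∑' n, b n * x ^ n = 0}.Finite := by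
  induction N generalizing b with
  | zero =>
    convert Set.finite_empty
    refine Set.eq_empty_of_forall_notMem fun u ⟨hu, h0⟩ => ?_
    rw [(summable_mul_of_tendsto_zero hb fun n => by
      rw [norm_pow]; exact pow_le_one₀ (norm_nonneg _) hu).tsum_eq_zero_add] at h0
    have hle : ‖∑' n, b (n + 1) * u ^ (n + 1)‖ ≤ r :=
      IsUltrametricDist.norm_tsum_le_of_forall_le fun n => by
        rw [norm_mul, norm_pow]
        exact (mul_le_of_le_one_right (norm_nonneg _) (pow_le_one₀ (norm_nonneg _) hu)).trans
          (hr _ (by omega))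
    rw [pow_zero, mul_one, add_eq_zero_iff_eq_neg] at h0
    rw [h0, norm_neg] at hN
    exact hN.not_ge hle
  | succ N ih =>
    rcases Set.eq_empty_or_nonempty {x : K | ‖x‖ ≤ 1 ∧ ∑' n, b n * x ^ n = 0} with he | ⟨u, hu, h0⟩
    · rw [he]; exact Set.finite_empty
    obtain ⟨g, hgt, hrec, hbound, hfac⟩ := exists_quotient_of_tsum_eq_zero hb hu h0
    have hle : ‖u * g (N + 1)‖ ≤ r := by
      rw [norm_mul]
      exact (mul_le_of_le_one_left (norm_nonneg _) hu).trans (hbound _ _ hr)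
    have hgN : r < ‖g N‖ := by
      rw [hrec, IsUltrametricDist.norm_add_eq_max_of_norm_ne_norm (hle.trans_lt hN).ne']
      exact lt_max_of_lt_left hN
    refine ((ih hgt hgN fun n hn => hbound n r fun k hk => hr k (by omega)).insert u).subset ?_
    rintro x ⟨hx, hx0⟩
    rw [hfac x hx, mul_eq_zero, sub_eq_zero] at hx0
    exact hx0.imp id fun h => ⟨hx, h⟩

open Filter Topology in
/-- A convergent power series with infinitely many zeros in the closed unit disc is zero. -/
lemma coeff_eq_zero_of_infinite_zeros {K : Type*} [NormedField K] [CompleteSpace K]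
    [IsUltrametricDist K] {b : ℕ → K} (hb : Tendsto b cofinite (𝓝 0)) {S : Set K}
    (hS : S.Infinite) (hS1 : ∀ x ∈ S, ‖x‖ ≤ 1) (h0 : ∀ x ∈ S, ∑' n, b n * x ^ n = 0) (m : ℕ) :
    b m = 0 := by
  by_contra hm
  have hm' : 0 < ‖b m‖ := norm_pos_iff.2 hm
  have hfin : {n | ‖b m‖ / 2 < ‖b n‖}.Finite := by
    have := (tendsto_zero_iff_norm_tendsto_zero.1 hb).eventually_lt_const (half_pos hm')
    refine (eventually_cofinite.1 this).subset fun n hn => ?_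
    exact lt_asymm hn
  obtain ⟨N, hN⟩ := hfin.exists_maximal ⟨m, half_lt_self hm'⟩
  refine hS ((finite_zeros_of_dominant_coeff N hb hN.prop fun n hn => ?_).subset
    fun x hx => ⟨hS1 x hx, h0 x hx⟩)
  by_contra! h
  exact hn.not_ge (hN.le_of_ge h hn.le)

open Filter Topology in
/-- A convergent multivariate power series on the closed unit polydisc that vanishes on a product
of infinite sets is zero. -/
lemma coeff_eq_zero_of_vanish_on_pi {K : Type*} [NormedField K] [CompleteSpace K]
    [IsUltrametricDist K] (d : ℕ) {a : (Fin d → ℕ) → K} (ha : Tendsto a cofinite (𝓝 0))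
    {S : Fin d → Set K} (hS : ∀ i, (S i).Infinite) (hS1 : ∀ i, ∀ x ∈ S i, ‖x‖ ≤ 1)
    (h0 : ∀ x : Fin d → K, (∀ i, x i ∈ S i) → ∑' I, a I * ∏ i, x i ^ I i = 0)
    (I : Fin d → ℕ) : a I = 0 := by
  induction d with
  | zero =>
    have := h0 finZeroElim finZeroElim
    rw [tsum_eq_single I fun J hJ => absurd (Subsingleton.elim J I) hJ] at this
    simpa using this
  | succ d ih =>
    let e : ℕ × (Fin d → ℕ) ≃ (Fin (d + 1) → ℕ) := Fin.consEquiv fun _ => ℕ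
    have hae : Tendsto (fun q => a (e q)) cofinite (𝓝 0) := ha.comp e.injective.tendsto_cofinite
    have hw : ∀ x : Fin d → K, (∀ i, x i ∈ S i.succ) → ∀ J : Fin d → ℕ, ‖∏ i, x i ^ J i‖ ≤ 1 :=
      fun x hx J => by
        rw [norm_prod]
        refine Finset.prod_le_one (fun _ _ => norm_nonneg _) fun i _ => ?_
        rw [norm_pow]
        exact pow_le_one₀ (norm_nonneg _) (hS1 _ _ (hx i))
    have key : ∀ n, ∀ x : Fin d → K, (∀ i, x i ∈ S i.succ) →
        ∑' J, a (e (n, J)) * ∏ i, x i ^ J i = 0 := by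
      intro n x hx
      have hsum := summable_mul_of_tendsto_zero hae (w := fun q => ∏ i, x i ^ q.2 i)
        fun q => hw x hx q.2
      refine coeff_eq_zero_of_infinite_zeros
        (b := fun n => ∑' J, a (e (n, J)) * ∏ i, x i ^ J i)
        hsum.prod.tendsto_cofinite_zero (hS 0) (hS1 0) (fun t ht => ?_) n
      have hsum' := summable_mul_of_tendsto_zero hae
        (w := fun q => (∏ i, x i ^ q.2 i) * t ^ q.1) fun q => by
          rw [norm_mul, norm_pow]
          exact mul_le_one₀ (hw x hx q.2) (by positivity)
            (pow_le_one₀ (norm_nonneg _) (hS1 0 t ht))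
      have := h0 (Fin.cons t x) (Fin.cases ht hx)
      rw [← e.tsum_eq] at this
      rw [← this]
      simp_rw [← tsum_mul_right]
      rw [← Summable.tsum_prod (f := fun q : ℕ × (Fin d → ℕ) =>
        a (e q) * (∏ i, x i ^ q.2 i) * t ^ q.1) (by simpa only [mul_assoc] using hsum')]
      refine tsum_congr fun q => ?_
      rw [Fin.prod_univ_succ]
      simp only [e, Fin.consEquiv_apply, Fin.cons_zero, Fin.cons_succ]
      ring
    obtain ⟨⟨n, J⟩, rfl⟩ := e.surjective I
    exact ih (a := fun J => a (e (n, J)))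
      (hae.comp (Prod.mk_right_injective n).tendsto_cofinite)
      (fun i => hS i.succ) (fun i => hS1 i.succ) (key n) J

/-- Nonempty open sets of `p`-adic integers are infinite. -/
lemma PadicInt.infinite_of_isOpen {p : ℕ} [Fact p.Prime] {V : Set ℤ_[p]} (hV : IsOpen V)
    (hne : V.Nonempty) : V.Infinite := by
  obtain ⟨u, hu⟩ := hne
  obtain ⟨ε, hε, hball⟩ := Metric.isOpen_iff.1 hV u hu
  obtain ⟨k, hk⟩ := PadicInt.exists_pow_neg_lt p hε
  refine (Set.infinite_range_of_injective (f := fun n : ℕ => u + (p : ℤ_[p]) ^ k * n)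
    fun m n h => ?_).mono ?_
  · have hp : (p : ℤ_[p]) ^ k ≠ 0 :=
      pow_ne_zero _ (Nat.cast_ne_zero.2 (Fact.out : p.Prime).ne_zero)
    exact_mod_cast mul_left_cancel₀ hp (add_left_cancel h)
  · rintro _ ⟨n, rfl⟩
    refine hball ?_
    rw [Metric.mem_ball, dist_eq_norm, add_sub_cancel_left, norm_mul, PadicInt.norm_p_pow]
    exact (mul_le_of_le_one_right (by positivity) (PadicInt.norm_le_one _)).trans_lt hk

/-- **Analytic continuation for Tate-analytic functions.** Let `a : (Fin d →₀ ℕ) → ℚ_p` be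
coefficients with `‖a_I‖ → 0`, defining `F(x) = ∑'_I a_I ∏_i x_i^{I_i}` on `ℤ_p^d`. If `F`
vanishes identically on a nonempty open subset of `ℤ_p^d`, then all the `a_I` are zero. -/
theorem tate_analytic_continuation (p : ℕ) [Fact p.Prime] (d : ℕ) (hd : 1 ≤ d)
    (a : (Fin d →₀ ℕ) → ℚ_[p])
    (ha : Filter.Tendsto (fun I : Fin d →₀ ℕ => ‖a I‖) Filter.cofinite (nhds 0))
    (U : Set (Fin d → ℤ_[p])) (hU : IsOpen U) (hUne : U.Nonempty)
    (hvanish : ∀ x ∈ U,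
      (∑' I : Fin d →₀ ℕ, a I * ∏ i : Fin d, ((x i : ℚ_[p]) ^ (I i))) = 0) :
    ∀ I : Fin d →₀ ℕ, a I = 0 := by
  obtain ⟨u, hu⟩ := hUne
  obtain ⟨V, hV, hVU⟩ := isOpen_pi_iff'.1 hU u hu
  let e : (Fin d →₀ ℕ) ≃ (Fin d → ℕ) := Finsupp.equivFunOnFinite
  intro I
  have key := coeff_eq_zero_of_vanish_on_pi d (a := fun J => a (e.symm J))
    ((tendsto_zero_iff_norm_tendsto_zero.2 ha).comp e.symm.injective.tendsto_cofinite)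
    (S := fun i => (↑) '' V i)
    (fun i => (PadicInt.infinite_of_isOpen (hV i).1 ⟨u i, (hV i).2⟩).image
      Subtype.val_injective.injOn)
    (by rintro i _ ⟨x, -, rfl⟩; exact x.2)
    (fun x hx => by
      choose y hy hyx using hx
      obtain rfl : (fun i => (y i : ℚ_[p])) = x := funext hyx
      rw [← hvanish y (hVU fun i _ => hy i), ← e.symm.tsum_eq]
      rfl) (e I)
  simpa using key
end
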